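/- arXiv:1708.05274 — 2 statements merged into one kernel-verified Lean document; each statement's English description precedes it below -/
import Mathlib

section
/- Every full exceptional sequence in mod kA_s (finite-dimensional modules over the path algebra of the equioriented A_s quiver) contains a simple module, and every silting object in D^b(mod kA_s) contains a shift of a simple module as a direct summand. -/
open CategoryTheory CategoryTheory.Limits

universe v u

variable (k : Type*) [Field k]

section Defs

variable {A : Type u} [Category.{v} A] [Abelian A] [Linear k A]

/-- `Ext¹(X, Y) = 0`, expressed by the splitting of every short exact sequence
`0 → Y → M → X → 0`. -/
def Ext1IsZero (X Y : A) : Prop :=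
  ∀ (M : A) (i : Y ⟶ M) (p : M ⟶ X) (w : i ≫ p = 0), Mono i → Epi p →
    (ShortComplex.mk i p w).Exact → ∃ r : M ⟶ Y, i ≫ r = 𝟙 Y

/-- Hereditariness (`Ext² = 0`): every extension of a subobject extends to the ambient
object. -/
def Hereditary : Prop :=
  ∀ (K Y W : A) (m : K ⟶ Y), Mono m →
    ∀ (M : A) (i : W ⟶ M) (p : M ⟶ K) (w : i ≫ p = 0), Mono i → Epi p →
      (ShortComplex.mk i p w).Exact →
      ∃ (N : A) (i' : W ⟶ N) (p' : N ⟶ Y) (w' : i' ≫ p' = 0) (q : M ⟶ N),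
        Mono i' ∧ Epi p' ∧ (ShortComplex.mk i' p' w').Exact ∧
          i ≫ q = i' ∧ q ≫ p' = p ≫ m

/-- `P` is a thick-generation predicate witness: `P` contains the zero objects and is closed
under isomorphisms, kernels, cokernels, extensions and direct summands. -/
def ThickClosed (P : A → Prop) : Prop :=
  (∀ X : A, IsZero X → P X) ∧
  (∀ X Y : A, (X ≅ Y) → P X → P Y) ∧
  (∀ (X Y : A) (f : X ⟶ Y), P X → P Y → P (kernel f)) ∧
  (∀ (X Y : A) (f : X ⟶ Y), P X → P Y → P (cokernel f)) ∧
  (∀ (X Y Z : A) (i : X ⟶ Y) (p : Y ⟶ Z) (w : i ≫ p = 0), Mono i → Epi p →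
    (ShortComplex.mk i p w).Exact → P X → P Z → P Y) ∧
  (∀ X Y : A, (∃ (s : X ⟶ Y) (r : Y ⟶ X), s ≫ r = 𝟙 X) → P Y → P X)

end Defs

/-- The data exhibiting an abelian category `A` as the category `mod kA_s` of
finite-dimensional right modules over the path algebra of the equioriented `A_s`-quiver
`1 → 2 → ⋯ → s`: a Hom-finite hereditary uniserial length `k`-category whose simple objects
are `S 0, …, S (s-1)` with the extensions dictated by the quiver. -/
structure ModAData (s : ℕ) (A : Type u) [Category.{v} A] [Abelian A] [Linear k A] where
  homFinite : ∀ X Y : A, FiniteDimensional k (X ⟶ Y)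
  finiteLength : ∀ X : A, WellFoundedGT (Subobject X) ∧ WellFoundedLT (Subobject X)
  uniserial : ∀ X : A, Indecomposable X → ∀ a b : Subobject X, a ≤ b ∨ b ≤ a
  hereditary : Hereditary (A := A)
  simples : Fin s → A
  simple_simples : ∀ i, Simple (simples i)
  simples_exhaustive : ∀ S : A, Simple S → ∃ i, Nonempty (S ≅ simples i)
  simples_distinct : ∀ i j, Nonempty (simples i ≅ simples j) → i = j
  ext_pattern : ∀ i j : Fin s,
    ¬ Ext1IsZero (A := A) (simples i) (simples j) ↔ (i : ℕ) + 1 = (j : ℕ)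

variable {A : Type u} [Category.{v} A] [Abelian A] [Linear k A]

section Helpers


lemma exists_retraction_of_section {X M Z : A} (i : X ⟶ M) (p : M ⟶ Z) (w : i ≫ p = 0)
    (hi : Mono i) (ex : (ShortComplex.mk i p w).Exact) (t : Z ⟶ M) (ht : t ≫ p = 𝟙 Z) :
    ∃ r : M ⟶ X, i ≫ r = 𝟙 X :=
  let sp := ShortComplex.Splitting.ofExactOfSection _ ex t ht hi
  ⟨sp.r, sp.f_r⟩

lemma exists_section_of_retraction {X M Z : A} (i : X ⟶ M) (p : M ⟶ Z) (w : i ≫ p = 0)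
    (hp : Epi p) (ex : (ShortComplex.mk i p w).Exact) (r : M ⟶ X) (hr : i ≫ r = 𝟙 X) :
    ∃ t : Z ⟶ M, t ≫ p = 𝟙 Z :=
  let sp := ShortComplex.Splitting.ofExactOfRetraction _ ex r hr hp
  ⟨sp.s, sp.s_g⟩

/-- If `Ext¹(Z,Y) = 0`, maps to `Y` extend along monos with cokernel `Z`. -/
lemma Ext1IsZero.extend {Z Y : A} (h : Ext1IsZero Z Y) {X M : A} (i : X ⟶ M) (p : M ⟶ Z)
    (w : i ≫ p = 0) (hi : Mono i) (hp : Epi p) (ex : (ShortComplex.mk i p w).Exact)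
    (g : X ⟶ Y) : ∃ u : M ⟶ Y, i ≫ u = g := by
  let q : pushout i g ⟶ Z := pushout.desc p 0 (by simp [w])
  have hq : pushout.inl i g ≫ q = p := pushout.inl_desc _ _ _
  have w' : pushout.inr i g ≫ q = 0 := pushout.inr_desc _ _ _
  have hq' : Epi q := by
    have : Epi (pushout.inl i g ≫ q) := by rw [hq]; exact hp
    exact epi_of_epi (pushout.inl i g) q
  have ex' : (ShortComplex.mk _ q w').Exact := by
    apply ShortComplex.exact_of_g_is_cokernel
    refine CokernelCofork.IsColimit.ofπ' _ _ (fun {T} t ht => ?_)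
    have h1 : i ≫ pushout.inl i g ≫ t = 0 := by
      rw [pushout.condition_assoc]; simp at ht; simp [ht]
    refine Classical.choice ?_
    obtain ⟨d, hd⟩ := ex.desc' (pushout.inl i g ≫ t) h1
    refine ⟨⟨d, ?_⟩⟩
    apply pushout.hom_ext
    · dsimp at d hd ⊢
      rw [reassoc_of% hq, hd]
    · dsimp at ht ⊢
      rw [reassoc_of% w', ht]; simp
  obtain ⟨r, hr⟩ := h _ _ q w' inferInstance hq' ex'
  exact ⟨pushout.inl i g ≫ r, by rw [pushout.condition_assoc, hr]; simp⟩

/-- If `Ext¹(Z,Y) = 0`, maps from `Z` lift along epis with kernel `Y`. -/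
lemma Ext1IsZero.lift {Z Y : A} (h : Ext1IsZero Z Y) {M N : A} (i : Y ⟶ M) (p : M ⟶ N)
    (w : i ≫ p = 0) (hi : Mono i) (hp : Epi p) (ex : (ShortComplex.mk i p w).Exact)
    (g : Z ⟶ N) : ∃ u : Z ⟶ M, u ≫ p = g := by
  let j : Y ⟶ pullback p g := pullback.lift i 0 (by simp [w])
  have hj : j ≫ pullback.fst p g = i := pullback.lift_fst _ _ _
  have w' : j ≫ pullback.snd p g = 0 := pullback.lift_snd _ _ _
  have hj' : Mono j := by
    have : Mono (j ≫ pullback.fst p g) := by rw [hj]; exact hi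
    exact mono_of_mono j (pullback.fst p g)
  have ex' : (ShortComplex.mk j _ w').Exact := by
    apply ShortComplex.exact_of_f_is_kernel
    refine KernelFork.IsLimit.ofι' _ _ (fun {T} t ht => ?_)
    have h1 : (t ≫ pullback.fst p g) ≫ p = 0 := by
      rw [Category.assoc, pullback.condition]; dsimp at ht; rw [reassoc_of% ht]; simp
    refine Classical.choice ?_
    obtain ⟨d, hd⟩ := ex.lift' (t ≫ pullback.fst p g) h1
    refine ⟨⟨d, ?_⟩⟩
    apply pullback.hom_ext
    · dsimp at d hd ⊢
      rw [Category.assoc, hj, hd]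
    · dsimp at ht ⊢
      rw [Category.assoc, w', ht]; simp
  obtain ⟨r, hr⟩ := h _ j _ w' hj' inferInstance ex'
  obtain ⟨t, ht⟩ := exists_section_of_retraction _ _ w' inferInstance ex' r hr
  exact ⟨t ≫ pullback.fst p g, by rw [Category.assoc, pullback.condition, reassoc_of% ht]⟩

lemma Ext1IsZero.retract_right {Z X Y : A} (h : Ext1IsZero Z Y) (s : X ⟶ Y) (r : Y ⟶ X)
    (hsr : s ≫ r = 𝟙 X) : Ext1IsZero Z X := by
  intro M i p w hi hp ex
  obtain ⟨u, hu⟩ := h.extend i p w hi hp ex s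
  exact ⟨u ≫ r, by rw [reassoc_of% hu, hsr]⟩

lemma Ext1IsZero.retract_left {Z Z' Y : A} (h : Ext1IsZero Z Y) (s : Z' ⟶ Z) (r : Z ⟶ Z')
    (hsr : s ≫ r = 𝟙 Z') : Ext1IsZero Z' Y := by
  intro M i p w hi hp ex
  obtain ⟨u, hu⟩ := h.lift i p w hi hp ex r
  exact exists_retraction_of_section i p w hi ex (s ≫ u) (by rw [Category.assoc, hu, hsr])

/-- Quotients: right exactness of `Ext¹(Z,-)` from hereditariness. -/
lemma Ext1IsZero.quotient (hH : Hereditary (A := A)) {Z X I : A} (h : Ext1IsZero Z X)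
    (e : X ⟶ I) [Epi e] : Ext1IsZero Z I := by
  intro M m p w hm hp ex
  have ex0 : (ShortComplex.mk (kernel.ι e) e (kernel.condition e)).Exact :=
    ShortComplex.exact_of_f_is_kernel _ (kernelIsKernel e)
  obtain ⟨N, i', p', w', q, hi', hp', ex', hq1, hq2⟩ :=
    hH I M (kernel e) m hm X (kernel.ι e) e (kernel.condition e) inferInstance inferInstance ex0
  have w2 : q ≫ (p' ≫ p) = 0 := by rw [reassoc_of% hq2, w]; simp
  have hqm : Mono q := by
    refine Preadditive.mono_of_cancel_zero _ (fun {T} t ht => ?_)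
    have h1 : t ≫ e = 0 := by
      rw [← cancel_mono m, Category.assoc, ← hq2, reassoc_of% ht]; simp
    have h2 : kernel.lift e t h1 ≫ i' = 0 := by
      rw [← hq1]; simp [ht]
    have h3 : kernel.lift e t h1 = 0 := by rwa [← cancel_mono i', zero_comp]
    rw [← kernel.lift_ι e t h1, h3, zero_comp]
  have hpe : Epi (p' ≫ p) := epi_comp _ _
  have ex2 : (ShortComplex.mk q (p' ≫ p) w2).Exact := by
    rw [ShortComplex.exact_iff_exact_up_to_refinements]
    intro T x hx
    dsimp at x hx
    obtain ⟨y, hy⟩ := ex.lift' (x ≫ p') (by simpa using hx)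
    dsimp at y hy
    obtain ⟨T', π, hπ, z, hz⟩ := surjective_up_to_refinements_of_epi e y
    obtain ⟨a, ha⟩ := ex'.lift' (π ≫ x - z ≫ q) (by
      dsimp
      simp only [Preadditive.sub_comp, Category.assoc, hq2]
      rw [← hy, reassoc_of% hz]; simp)
    dsimp at a ha
    refine ⟨T', π, hπ, z + a ≫ kernel.ι e, ?_⟩
    dsimp
    rw [Preadditive.add_comp, Category.assoc, hq1, ha]; simp
  obtain ⟨u, hu⟩ := h.lift q (p' ≫ p) w2 hqm hpe ex2 (𝟙 Z)
  exact exists_retraction_of_section m p w hm ex (u ≫ p') (by rw [Category.assoc, hu])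

/-- The right perpendicular category of `Z` is thick. -/
lemma thickClosed_perp (hH : Hereditary (A := A)) (Z : A) :
    ThickClosed (A := A) (fun X => (∀ f : Z ⟶ X, f = 0) ∧ Ext1IsZero Z X) := by
  have hret : ∀ X Y : A, (∃ (s : X ⟶ Y) (r : Y ⟶ X), s ≫ r = 𝟙 X) →
      ((∀ f : Z ⟶ Y, f = 0) ∧ Ext1IsZero Z Y) → ((∀ f : Z ⟶ X, f = 0) ∧ Ext1IsZero Z X) := by
    rintro X Y ⟨s, r, hsr⟩ ⟨h1, h2⟩
    refine ⟨fun f => ?_, h2.retract_right s r hsr⟩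
    rw [← Category.comp_id f, ← hsr, ← Category.assoc, h1 (f ≫ s), zero_comp]
  refine ⟨?_, ?_, ?_, ?_, ?_, hret⟩
  · intro X hX
    exact ⟨fun f => hX.eq_of_tgt _ _, fun M i p w hi hp ex => ⟨0, hX.eq_of_src _ _⟩⟩
  · intro X Y e hX
    exact hret Y X ⟨e.inv, e.hom, by simp⟩ hX
  · rintro X Y f ⟨hX1, hX2⟩ ⟨hY1, hY2⟩
    refine ⟨fun g => ?_, ?_⟩
    · rw [← cancel_mono (kernel.ι f), hX1 (g ≫ kernel.ι f), zero_comp]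
    · intro M i p w hi hp ex
      obtain ⟨u, hu⟩ := hX2.extend i p w hi hp ex (kernel.ι f)
      have h0 : i ≫ (u ≫ f) = 0 := by rw [reassoc_of% hu]; simp
      have h1 : u ≫ f = 0 := by
        have := ex.g_desc (u ≫ f) h0
        rw [← this, hY1 (ex.desc (u ≫ f) h0), comp_zero]
      exact ⟨kernel.lift f u h1, by rw [← cancel_mono (kernel.ι f)]; simp [hu]⟩
  · rintro X Y f ⟨hX1, hX2⟩ ⟨hY1, hY2⟩
    refine ⟨fun g => ?_, hY2.quotient hH (cokernel.π f)⟩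
    have hI : Ext1IsZero Z (Abelian.image f) := hX2.quotient hH (Abelian.factorThruImage f)
    have ex : (ShortComplex.mk (Abelian.image.ι f) (cokernel.π f) (by simp)).Exact :=
      ShortComplex.exact_of_f_is_kernel _ (kernelIsKernel (cokernel.π f))
    obtain ⟨u, hu⟩ := hI.lift _ _ _ inferInstance inferInstance ex g
    rw [← hu, hY1 u, zero_comp]
  · rintro X Y W i p w hi hp ex ⟨hX1, hX2⟩ ⟨hW1, hW2⟩
    refine ⟨fun f => ?_, ?_⟩
    · obtain ⟨u, hu⟩ := ex.lift' f (hW1 _)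
      dsimp at u hu
      rw [← hu, hX1 u, zero_comp]
    · intro M i2 p2 w2 hi2 hp2 ex2
      obtain ⟨h, hh⟩ := hW2.extend i2 p2 w2 hi2 hp2 ex2 p
      have w3 : (i ≫ i2) ≫ biprod.lift h p2 = 0 := by
        apply biprod.hom_ext <;> simp [hh, w, w2]
      have hm3 : Mono (i ≫ i2) := mono_comp _ _
      have he3 : Epi (biprod.lift h p2) := by
        rw [epi_iff_surjective_up_to_refinements]
        intro T y
        obtain ⟨T1, π1, hπ1, x1, hx1⟩ := surjective_up_to_refinements_of_epi p2 (y ≫ biprod.snd)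
        obtain ⟨T2, π2, hπ2, x2, hx2⟩ := surjective_up_to_refinements_of_epi p
          (π1 ≫ y ≫ biprod.fst - x1 ≫ h)
        refine ⟨T2, π2 ≫ π1, epi_comp _ _, π2 ≫ x1 + x2 ≫ i2, ?_⟩
        apply biprod.hom_ext
        · simp only [Category.assoc, Preadditive.add_comp, biprod.lift_fst, hh, ← hx2,
            Preadditive.comp_sub]
          abel
        · simp [hx1, w2]
      have ex3 : (ShortComplex.mk _ _ w3).Exact := by
        rw [ShortComplex.exact_iff_exact_up_to_refinements]
        intro T x hx
        dsimp at x hx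
        have hxh : x ≫ h = 0 := by simpa using congrArg (· ≫ biprod.fst) hx
        have hxp : x ≫ p2 = 0 := by simpa using congrArg (· ≫ biprod.snd) hx
        obtain ⟨y, hy⟩ := ex2.lift' x hxp
        dsimp at y hy
        obtain ⟨z, hz⟩ := ex.lift' y (show y ≫ p = 0 by simp only [← hh, reassoc_of% hy, hxh])
        dsimp at z hz
        exact ⟨T, 𝟙 T, inferInstance, z, by simp [reassoc_of% hz, hy]⟩
      obtain ⟨u, hu⟩ := hX2.lift _ _ w3 hm3 he3 ex3 biprod.inr
      refine exists_retraction_of_section i2 p2 w2 hi2 ex2 u ?_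
      simpa using congrArg (· ≫ biprod.snd) hu

/-! ### Uniserial objects -/

lemma finite_of_chain {α : Type*} [PartialOrder α] [WellFoundedLT α] [WellFoundedGT α]
    (h : ∀ a b : α, a ≤ b ∨ b ≤ a) : Finite α := by
  classical
  let _ : LinearOrder α :=
    { (inferInstance : PartialOrder α) with
      le_total := h
      toDecidableLE := Classical.decRel _ }
  exact Finite.of_wellFoundedLT_wellFoundedGT α

/-- The subobjects of `X` form a chain. -/
def IsChainObj (X : A) : Prop := ∀ a b : Subobject X, a ≤ b ∨ b ≤ a

lemma IsChainObj.factor {X : A} (h : IsChainObj X) {B C : A} (f : B ⟶ X) (g : C ⟶ X)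
    [Mono f] [Mono g] : (∃ t : B ⟶ C, t ≫ g = f) ∨ (∃ t : C ⟶ B, t ≫ f = g) := by
  rcases h (Subobject.mk f) (Subobject.mk g) with h | h
  · exact Or.inl ⟨Subobject.ofMkLEMk f g h, Subobject.ofMkLEMk_comp h⟩
  · exact Or.inr ⟨Subobject.ofMkLEMk g f h, Subobject.ofMkLEMk_comp h⟩

/-- If a sum of two maps into a chain object is epi, one of them is. -/
lemma IsChainObj.epi_or_epi {Z : A} (h : IsChainObj Z) {M N : A} (f : M ⟶ Z) (g : N ⟶ Z)
    (hfg : Epi (biprod.desc f g)) : Epi f ∨ Epi g := by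
  have key : ∀ {M N : A} (f : M ⟶ Z) (g : N ⟶ Z)
      (hc : ∀ {W : A} (c : Z ⟶ W), f ≫ c = 0 → g ≫ c = 0 → c = 0)
      (t : Abelian.image f ⟶ Abelian.image g)
      (_ : t ≫ Abelian.image.ι g = Abelian.image.ι f), Epi g := by
    intro M N f g hc t ht
    refine Preadditive.epi_of_cancel_zero _ (fun {W} c hgc => hc c ?_ hgc)
    have h1 : Abelian.image.ι g ≫ c = 0 := by
      rw [← cancel_epi (Abelian.factorThruImage g)]
      simp [hgc]
    rw [← Abelian.image.fac f, Category.assoc, ← ht, Category.assoc, h1]; simp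
  have hc : ∀ {W : A} (c : Z ⟶ W), f ≫ c = 0 → g ≫ c = 0 → c = 0 := by
    intro W c h1 h2
    rw [← cancel_epi (biprod.desc f g), comp_zero]
    apply biprod.hom_ext' <;> simp [h1, h2]
  rcases h.factor (Abelian.image.ι f) (Abelian.image.ι g) with ⟨t, ht⟩ | ⟨t, ht⟩
  · exact Or.inr (key f g hc t ht)
  · exact Or.inl (key g f (fun c h1 h2 => hc c h2 h1) t ht)

/-- Nonzero quotient maps out of chain objects are superfluous epis. -/
lemma IsChainObj.epi_of_epi_comp {E : A} (h : IsChainObj E) {Q Z : A} (a : Q ⟶ E) (π : E ⟶ Z)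
    [Epi π] (hZ : ¬ IsZero Z) (ha : Epi (a ≫ π)) : Epi a := by
  rcases h.factor (kernel.ι π) (Abelian.image.ι a) with ⟨t, ht⟩ | ⟨t, ht⟩
  · refine Preadditive.epi_of_cancel_zero _ (fun {W} c hc => ?_)
    have h1 : Abelian.image.ι a ≫ c = 0 := by
      rw [← cancel_epi (Abelian.factorThruImage a)]
      simp [hc]
    have ex : (ShortComplex.mk (kernel.ι π) π (kernel.condition π)).Exact :=
      ShortComplex.exact_of_f_is_kernel _ (kernelIsKernel π)
    obtain ⟨d, hd⟩ := ex.desc' c (show kernel.ι π ≫ c = 0 by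
      rw [← ht, Category.assoc, h1, comp_zero])
    dsimp at d hd
    have h2 : d = 0 := by
      rw [← cancel_epi (a ≫ π), Category.assoc, hd, hc, comp_zero]
    rw [← hd, h2, comp_zero]
  · exfalso
    apply hZ
    have h0 : a ≫ π = 0 := by
      rw [← Abelian.image.fac a, ← ht]; simp
    rw [IsZero.iff_id_eq_zero, ← cancel_epi (a ≫ π), h0, zero_comp, zero_comp]

lemma pullback_le_pullback_iff {E X : A} (g : E ⟶ X) [Epi g] {a b : Subobject X}
    (h : (Subobject.pullback g).obj a ≤ (Subobject.pullback g).obj b) : a ≤ b := by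
  have h1 := Subobject.isPullback g a
  have h2 := Subobject.isPullback g b
  have h3 : IsPullback _ _ _ _ := IsPullback.of_hasPullback a.arrow g
  have hepi : Epi (Subobject.pullbackπ g a) := by
    have e : Subobject.pullbackπ g a = (h1.isoPullback).hom ≫ pullback.fst a.arrow g := by simp
    rw [e]; infer_instance
  have sq : CommSq (Subobject.ofLE _ _ h ≫ Subobject.pullbackπ g b) (Subobject.pullbackπ g a)
      b.arrow a.arrow := ⟨by rw [Category.assoc, h2.w, h1.w, Subobject.ofLE_arrow_assoc]⟩
  have : StrongEpi (Subobject.pullbackπ g a) := strongEpi_of_epi _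
  exact Subobject.le_of_comm sq.lift sq.fac_right

lemma IsChainObj.quotient {E X : A} (h : IsChainObj E) (g : E ⟶ X) [Epi g] : IsChainObj X :=
  fun a b => (h ((Subobject.pullback g).obj a) ((Subobject.pullback g).obj b)).imp
    (pullback_le_pullback_iff g) (pullback_le_pullback_iff g)

lemma card_lt_of_mono {E X : A} [Finite (Subobject E)] (f : X ⟶ E) [Mono f] (hf : ¬ Epi f) :
    Nat.card (Subobject X) < Nat.card (Subobject E) := by
  have hinj : Function.Injective (Subobject.map f).obj := Subobject.map_obj_injective f
  refine lt_of_le_of_ne (Nat.card_le_card_of_injective _ hinj) (fun heq => hf ?_)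
  have hb := (Function.Injective.bijective_of_nat_card_le hinj heq.ge)
  obtain ⟨a, ha⟩ := hb.2 ⊤
  have h1 : (Subobject.map f).obj ⊤ = ⊤ := by
    apply top_le_iff.mp
    rw [← ha]
    exact (Subobject.map f).monotone le_top
  rw [Subobject.map_top] at h1
  have : IsIso f := (Subobject.isIso_iff_mk_eq_top f).2 h1
  infer_instance

lemma card_lt_of_epi {E X : A} [Finite (Subobject E)] (g : E ⟶ X) [Epi g] (hg : ¬ Mono g) :
    Nat.card (Subobject X) < Nat.card (Subobject E) := by
  have hinj : Function.Injective (Subobject.pullback g).obj := fun a b hab =>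
    le_antisymm (pullback_le_pullback_iff g hab.le) (pullback_le_pullback_iff g hab.ge)
  refine lt_of_le_of_ne (Nat.card_le_card_of_injective _ hinj) (fun heq => hg ?_)
  have hb := (Function.Injective.bijective_of_nat_card_le hinj heq.ge)
  obtain ⟨a, ha⟩ := hb.2 ⊥
  refine Preadditive.mono_of_cancel_zero _ (fun {T} t ht => ?_)
  have h1 := Subobject.isPullback g a
  let l := h1.lift 0 t (by simp [ht])
  have hl : l ≫ ((Subobject.pullback g).obj a).arrow = t := h1.lift_snd _ _ _
  have h0 : ((Subobject.pullback g).obj a).arrow = 0 := by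
    rw [ha]; exact Subobject.bot_arrow
  rw [← hl, h0, comp_zero]

/-- A retract of an indecomposable object is zero or everything. -/
lemma retract_indec {X I : A} (hX : Indecomposable X) (s : I ⟶ X) (r : X ⟶ I)
    (h : s ≫ r = 𝟙 I) : IsZero I ∨ (IsIso s ∧ IsIso r) := by
  have : Mono s := mono_of_mono_fac h
  have ex : (ShortComplex.mk s (cokernel.π s) (cokernel.condition s)).Exact :=
    ShortComplex.exact_of_g_is_cokernel _ (cokernelIsCokernel s)
  let sp := ShortComplex.Splitting.ofExactOfRetraction _ ex r h inferInstance
  rcases hX.2 _ _ sp.isoBinaryBiproduct with h1 | h1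
  · exact Or.inl h1
  · right
    have h2 : Epi s := by
      apply Preadditive.epi_of_isZero_cokernel
      exact h1
    have h3 : IsIso s := isIso_of_mono_of_epi s
    refine ⟨h3, ?_⟩
    have : r = inv s := by rw [← cancel_epi s]; simp [h]
    rw [this]; infer_instance

/-- Induction principle over direct sum decompositions. -/
lemma decomp_induction (hL : ∀ X : A, WellFoundedLT (Subobject X)) (Q : A → Prop)
    (h0 : ∀ X, IsZero X → Q X) (h1 : ∀ X, Indecomposable X → Q X)
    (h2 : ∀ X Y Z, (X ≅ Y ⊞ Z) → Q Y → Q Z → Q X) (X : A) : Q X := by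
  have hmain : ∀ (a : Subobject X) (Y : A) (m : Y ⟶ X) (_ : Mono m),
      Subobject.mk m = a → Q Y := by
    have := hL X
    intro a
    induction a using WellFoundedLT.induction with
    | ind a ih =>
      intro Y m hm hma
      by_cases hz : IsZero Y
      · exact h0 _ hz
      by_cases hi : Indecomposable Y
      · exact h1 _ hi
      simp only [Indecomposable, not_and, not_forall, not_or] at hi
      obtain ⟨Y1, Y2, e, hn1, hn2⟩ := hi hz
      refine h2 Y Y1 Y2 e ?_ ?_
      · refine ih (Subobject.mk (biprod.inl ≫ e.inv ≫ m)) ?_ Y1 _ inferInstance rfl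
        rw [← hma]
        refine lt_of_le_of_ne (Subobject.mk_le_mk_of_comm (biprod.inl ≫ e.inv) (by simp)) ?_
        intro heq
        apply hn2
        let t := Subobject.ofMkLEMk _ _ heq.ge
        have ht : t ≫ (biprod.inl ≫ e.inv ≫ m) = m := Subobject.ofMkLEMk_comp heq.ge
        have ht2 : t ≫ biprod.inl = e.hom := by
          rw [← cancel_mono (e.inv ≫ m)]; simpa using ht
        have ht3 : e.hom ≫ biprod.snd = 0 := by rw [← ht2]; simp
        rw [IsZero.iff_id_eq_zero, ← cancel_epi (biprod.snd : Y1 ⊞ Y2 ⟶ Y2), ← cancel_epi e.hom]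
        simp [ht3]
      · refine ih (Subobject.mk (biprod.inr ≫ e.inv ≫ m)) ?_ Y2 _ inferInstance rfl
        rw [← hma]
        refine lt_of_le_of_ne (Subobject.mk_le_mk_of_comm (biprod.inr ≫ e.inv) (by simp)) ?_
        intro heq
        apply hn1
        let t := Subobject.ofMkLEMk _ _ heq.ge
        have ht : t ≫ (biprod.inr ≫ e.inv ≫ m) = m := Subobject.ofMkLEMk_comp heq.ge
        have ht2 : t ≫ biprod.inr = e.hom := by
          rw [← cancel_mono (e.inv ≫ m)]; simpa using ht
        have ht3 : e.hom ≫ biprod.fst = 0 := by rw [← ht2]; simp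
        rw [IsZero.iff_id_eq_zero, ← cancel_epi (biprod.fst : Y1 ⊞ Y2 ⟶ Y1), ← cancel_epi e.hom]
        simp [ht3]
  exact hmain _ X (𝟙 X) inferInstance rfl

lemma isIso_of_mono_endo (k : Type*) [Field k] [Linear k A] {X : A}
    (hfin : FiniteDimensional k (X ⟶ X)) (φ : X ⟶ X) [Mono φ] : IsIso φ := by
  have hinj : Function.Injective (Linear.rightComp k X φ) := fun a b hab => by
    simpa [cancel_mono] using hab
  obtain ⟨ψ, hψ⟩ := (LinearMap.injective_iff_surjective.1 hinj) (𝟙 X)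
  have hψ' : ψ ≫ φ = 𝟙 X := by simpa using hψ
  have : Epi φ := epi_of_epi_fac hψ'
  exact isIso_of_mono_of_epi φ

lemma isIso_of_epi_endo (k : Type*) [Field k] [Linear k A] {X : A}
    (hfin : FiniteDimensional k (X ⟶ X)) (φ : X ⟶ X) [Epi φ] : IsIso φ := by
  have hinj : Function.Injective (Linear.leftComp k X φ) := fun a b hab => by
    simpa [cancel_epi] using hab
  obtain ⟨ψ, hψ⟩ := (LinearMap.injective_iff_surjective.1 hinj) (𝟙 X)
  have hψ' : φ ≫ ψ = 𝟙 X := by simpa using hψ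
  have : Mono φ := mono_of_mono_fac hψ'
  exact isIso_of_mono_of_epi φ

/-- A nonzero map that is neither mono nor epi forces a nontrivial extension. -/
lemma mono_or_epi_of_ext (k : Type*) [Field k] [Linear k A] (hH : Hereditary (A := A)) {X Y : A}
    (hfin : FiniteDimensional k (X ⟶ X)) (hX : IsChainObj X) (hY : Indecomposable Y)
    (hext : Ext1IsZero Y X) (f : X ⟶ Y) (hf : f ≠ 0) : Mono f ∨ Epi f := by
  by_contra! hcon
  obtain ⟨hnm, hne⟩ := hcon
  let I := Abelian.image f
  let e : X ⟶ I := Abelian.factorThruImage f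
  let ι : I ⟶ Y := Abelian.image.ι f
  have hfac : e ≫ ι = f := Abelian.image.fac f
  have he : Epi e := inferInstance
  have hι : Mono ι := inferInstance
  let W := kernel e
  let wm : W ⟶ X := kernel.ι e
  have hwm : wm ≫ e = 0 := kernel.condition e
  have hwmono : Mono wm := inferInstance
  have ex0 : (ShortComplex.mk wm e hwm).Exact :=
    ShortComplex.exact_of_f_is_kernel _ (kernelIsKernel e)
  obtain ⟨N, i', p', w', q, hi', hp', ex', hq1, hq2⟩ :=
    hH I Y W ι hι X wm e hwm hwmono he ex0
  have w2 : biprod.lift e q ≫ biprod.desc (-ι) p' = 0 := by simp [hq2]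
  have hm2 : Mono (biprod.lift e q) := by
    refine Preadditive.mono_of_cancel_zero _ (fun {T} t ht => ?_)
    have h1 : t ≫ e = 0 := by simpa using congrArg (· ≫ biprod.fst) ht
    have h2 : t ≫ q = 0 := by simpa using congrArg (· ≫ biprod.snd) ht
    obtain ⟨l, hl⟩ := ex0.lift' t h1
    dsimp at l hl
    have h3 : l = 0 := by
      rw [← cancel_mono i', ← hq1, reassoc_of% hl, h2, zero_comp]
    rw [← hl, h3, zero_comp]
  have he2 : Epi (biprod.desc (-ι) p') := by
    have : Epi (biprod.inr ≫ biprod.desc (-ι) p') := by rw [biprod.inr_desc]; exact hp'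
    exact epi_of_epi biprod.inr _
  have ex2 : (ShortComplex.mk _ _ w2).Exact := by
    rw [ShortComplex.exact_iff_exact_up_to_refinements]
    intro T x hx
    dsimp at x hx
    have hx' : (x ≫ biprod.snd) ≫ p' = (x ≫ biprod.fst) ≫ ι := by
      have hd : biprod.desc (-ι) p' = biprod.snd ≫ p' - biprod.fst ≫ ι := by
        apply biprod.hom_ext' <;> simp
      have hx2 : x ≫ (biprod.snd ≫ p' - biprod.fst ≫ ι) = 0 := hd ▸ hx
      rw [Preadditive.comp_sub, sub_eq_zero] at hx2
      simpa using hx2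
    obtain ⟨T', π, hπ, z, hz⟩ := surjective_up_to_refinements_of_epi e (x ≫ biprod.fst)
    obtain ⟨a, ha⟩ := ex'.lift' (π ≫ x ≫ biprod.snd - z ≫ q) (by
      dsimp
      rw [Preadditive.sub_comp, Category.assoc, hx', Category.assoc z, hq2, ← Category.assoc π, hz,
        Category.assoc, sub_self])
    dsimp at a ha
    refine ⟨T', π, hπ, z + a ≫ wm, ?_⟩
    dsimp
    apply biprod.hom_ext
    · simp [hz, hwm]
    · simp only [Category.assoc, biprod.lift_snd, Preadditive.add_comp, hq1, ha]
      abel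
  obtain ⟨r, hr⟩ := hext _ _ _ w2 hm2 he2 ex2
  let r2 := biprod.inr ≫ r
  let φ := q ≫ r2
  have hwφ : wm ≫ φ = wm := by
    have h1 : biprod.lift e q = e ≫ biprod.inl + q ≫ biprod.inr := by
      apply biprod.hom_ext <;> simp
    have h2 := congrArg (wm ≫ ·) hr
    rw [h1, Preadditive.add_comp, Preadditive.comp_add, Category.assoc, reassoc_of% hwm] at h2
    simpa [φ, r2] using h2
  have hw0 : wm ≠ 0 := by
    intro h0
    apply hnm
    have : Mono e := by
      refine Preadditive.mono_of_cancel_zero _ (fun {T} t ht => ?_)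
      obtain ⟨l, hl⟩ := ex0.lift' t ht
      dsimp at l hl
      rw [← hl, h0, comp_zero]
    rw [← hfac]; exact mono_comp _ _
  have hφ : Mono φ := by
    rcases hX.factor (kernel.ι φ) wm with ⟨t, ht⟩ | ⟨t, ht⟩
    · refine Preadditive.mono_of_kernel_zero ?_
      rw [← ht, ← hwφ, reassoc_of% ht, kernel.condition]
    · exfalso
      apply hw0
      rw [← hwφ, ← ht, Category.assoc, kernel.condition, comp_zero]
  have hφi : IsIso φ := isIso_of_mono_endo k hfin φ
  obtain ⟨ρ, hρ⟩ := ex'.desc' (r2 ≫ inv φ ≫ e) (show i' ≫ r2 ≫ inv φ ≫ e = 0 by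
    have : i' ≫ r2 = wm ≫ φ := by rw [← hq1, Category.assoc]
    rw [reassoc_of% this, IsIso.hom_inv_id_assoc, hwm])
  dsimp at ρ hρ
  have hret : ι ≫ ρ = 𝟙 I := by
    rw [← cancel_epi e, ← Category.assoc, ← hq2, Category.assoc, hρ, Category.comp_id]
    have : q ≫ r2 ≫ inv φ ≫ e = φ ≫ inv φ ≫ e := (Category.assoc _ _ _).symm
    rw [this, IsIso.hom_inv_id_assoc]
  rcases retract_indec hY ι ρ hret with hz | ⟨hi, -⟩
  · apply hf
    rw [← hfac, hz.eq_of_tgt e 0, zero_comp]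
  · apply hne
    rw [← hfac]; exact epi_comp _ _

/-- An epi onto a nonzero chain object restricts to an epi on some indecomposable summand. -/
lemma exists_indec_epi (hL : ∀ X : A, WellFoundedLT (Subobject X)) {Z : A} (hZ : IsChainObj Z)
    (hZ0 : ¬ IsZero Z) (Q : A) :
    ∀ g : Q ⟶ Z, Epi g → ∃ (Q1 : A) (s : Q1 ⟶ Q), Indecomposable Q1 ∧ Epi (s ≫ g) := by
  induction Q using decomp_induction hL with
  | h0 X hX =>
    intro g hg
    exfalso
    apply hZ0
    rw [IsZero.iff_id_eq_zero, ← cancel_epi g]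
    exact hX.eq_of_src _ _
  | h1 X hX => exact fun g hg => ⟨X, 𝟙 X, hX, by simpa using hg⟩
  | h2 X Y W e hY hW =>
    intro g hg
    have h1 : biprod.desc (biprod.inl ≫ e.inv ≫ g) (biprod.inr ≫ e.inv ≫ g) = e.inv ≫ g := by
      apply biprod.hom_ext' <;> simp
    have h2 : Epi (biprod.desc (biprod.inl ≫ e.inv ≫ g) (biprod.inr ≫ e.inv ≫ g)) := by
      rw [h1]; exact epi_comp _ _
    rcases hZ.epi_or_epi _ _ h2 with h | h
    · obtain ⟨Q1, s, hs1, hs2⟩ := hY _ h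
      exact ⟨Q1, s ≫ biprod.inl ≫ e.inv, hs1, by simpa using hs2⟩
    · obtain ⟨Q1, s, hs1, hs2⟩ := hW _ h
      exact ⟨Q1, s ≫ biprod.inr ≫ e.inv, hs1, by simpa using hs2⟩

lemma factor_of_kernel {Q B C : A} (a : Q ⟶ B) (b : Q ⟶ C) [Epi a]
    (h : kernel.ι a ≫ b = 0) : ∃ u : B ⟶ C, a ≫ u = b := by
  have ex : (ShortComplex.mk (kernel.ι a) a (kernel.condition a)).Exact :=
    ShortComplex.exact_of_f_is_kernel _ (kernelIsKernel a)
  exact ex.desc' b h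

/-- Two indecomposables with a common nonzero quotient are comparable over it. -/
lemma compare_over (hL : ∀ X : A, WellFoundedLT (Subobject X))
    (hU : ∀ X : A, Indecomposable X → IsChainObj X) {E M Z : A} (hE : Indecomposable E)
    (hM : Indecomposable M) (hZ0 : ¬ IsZero Z) (π : E ⟶ Z) (p : M ⟶ Z) [Epi π] [Epi p] :
    (∃ u : M ⟶ E, u ≫ π = p) ∨ (∃ u : E ⟶ M, u ≫ p = π) := by
  have hZ : IsChainObj Z := (hU E hE).quotient π
  obtain ⟨Q, s, hQ, hs⟩ := exists_indec_epi hL hZ hZ0 (pullback π p) (pullback.fst π p ≫ π)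
    (epi_comp _ _)
  let a := s ≫ pullback.fst π p
  let b := s ≫ pullback.snd π p
  have hab : a ≫ π = b ≫ p := by simp [a, b, pullback.condition]
  have ha' : Epi (a ≫ π) := by simpa [a] using hs
  have ha : Epi a := (hU E hE).epi_of_epi_comp a π hZ0 ha'
  have hb : Epi b := (hU M hM).epi_of_epi_comp b p hZ0 (hab ▸ ha')
  rcases (hU Q hQ).factor (kernel.ι a) (kernel.ι b) with ⟨t, ht⟩ | ⟨t, ht⟩
  · obtain ⟨u, hu⟩ := factor_of_kernel a b (by rw [← ht]; simp)
    exact Or.inr ⟨u, by rw [← cancel_epi a, reassoc_of% hu, hab]⟩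
  · obtain ⟨u, hu⟩ := factor_of_kernel b a (by rw [← ht]; simp)
    exact Or.inl ⟨u, by rw [← cancel_epi b, reassoc_of% hu, hab]⟩

/-- The almost split property. -/
lemma almost_split (hL : ∀ X : A, WellFoundedLT (Subobject X))
    (hU : ∀ X : A, Indecomposable X → IsChainObj X) {E S : A} (hE : Indecomposable E)
    (hS : Simple S) (κ : S ⟶ E) (hκ : Mono κ) (hZ0 : ¬ IsZero (cokernel κ)) (M : A) :
    ∀ p : M ⟶ cokernel κ, (∃ t, t ≫ p = 𝟙 _) ∨
      ∃ (u : M ⟶ E) (v : M ⟶ cokernel κ), p = u ≫ cokernel.π κ + v ∧ ¬ Epi v := by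
  have hZ : IsChainObj (cokernel κ) := (hU E hE).quotient (cokernel.π κ)
  have h0 : ∀ M : A, ¬ Epi (0 : M ⟶ cokernel κ) := by
    intro M h
    apply hZ0
    rw [IsZero.iff_id_eq_zero, ← cancel_epi (0 : M ⟶ cokernel κ)]
    simp
  induction M using decomp_induction hL with
  | h0 X hX => exact fun p => Or.inr ⟨0, 0, hX.eq_of_src _ _, h0 X⟩
  | h1 X hX =>
    intro p
    by_cases hp : Epi p
    · rcases compare_over hL hU hE hX hZ0 (cokernel.π κ) p with ⟨u, hu⟩ | ⟨u, hu⟩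
      · exact Or.inr ⟨u, 0, by simp [hu], h0 X⟩
      · have hue : Epi u := (hU X hX).epi_of_epi_comp u p hZ0 (by rw [hu]; infer_instance)
        have ex : (ShortComplex.mk κ (cokernel.π κ) (cokernel.condition κ)).Exact :=
          ShortComplex.exact_of_g_is_cokernel _ (cokernelIsCokernel κ)
        obtain ⟨l, hl⟩ := ex.lift' (kernel.ι u) (show kernel.ι u ≫ cokernel.π κ = 0 by
          rw [← hu]; simp)
        dsimp at l hl
        have hlm : Mono l := mono_of_mono_fac hl
        by_cases hl0 : l = 0
        · have hum : Mono u := Preadditive.mono_of_kernel_zero (by rw [← hl, hl0, zero_comp])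
          have hui : IsIso u := isIso_of_mono_of_epi u
          exact Or.inr ⟨inv u, 0, by rw [← hu]; simp, h0 X⟩
        · have hli : IsIso l := isIso_of_mono_of_nonzero hl0
          have h1 : κ ≫ u = 0 := by
            rw [← cancel_epi l, reassoc_of% hl]; simp
          left
          refine ⟨cokernel.desc κ u h1, ?_⟩
          rw [← cancel_epi (cokernel.π κ)]
          simp [hu]
    · exact Or.inr ⟨0, p, by simp, hp⟩
  | h2 X Y W e hY hW =>
    intro p
    rcases hY (biprod.inl ≫ e.inv ≫ p) with ⟨t, ht⟩ | ⟨u1, v1, h1, hv1⟩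
    · exact Or.inl ⟨t ≫ biprod.inl ≫ e.inv, by simpa using ht⟩
    rcases hW (biprod.inr ≫ e.inv ≫ p) with ⟨t, ht⟩ | ⟨u2, v2, h2, hv2⟩
    · exact Or.inl ⟨t ≫ biprod.inr ≫ e.inv, by simpa using ht⟩
    refine Or.inr ⟨e.hom ≫ biprod.desc u1 u2, e.hom ≫ biprod.desc v1 v2, ?_, ?_⟩
    · rw [← cancel_epi e.inv]
      apply biprod.hom_ext'
      · rw [h1]; simp
      · rw [h2]; simp
    · intro hepi
      have : Epi (biprod.desc v1 v2) := epi_of_epi e.hom _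
      rcases hZ.epi_or_epi _ _ this with h | h
      · exact hv1 h
      · exact hv2 h

lemma ext_zero_of_no_map (k : Type*) [Field k] [Linear k A]
    (hfin : ∀ X Y : A, FiniteDimensional k (X ⟶ Y))
    (hL : ∀ X : A, WellFoundedLT (Subobject X))
    (hU : ∀ X : A, Indecomposable X → IsChainObj X) {E S : A} (hE : Indecomposable E)
    (hS : Simple S) (κ : S ⟶ E) (hκ : Mono κ) (hZ0 : ¬ IsZero (cokernel κ)) (X : A)
    (hX : ∀ f : X ⟶ E, ¬ Epi f → f = 0) : Ext1IsZero (cokernel κ) X := by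
  have hZ : IsChainObj (cokernel κ) := (hU E hE).quotient (cokernel.π κ)
  intro M i p w hi hp ex
  rcases almost_split hL hU hE hS κ hκ hZ0 M p with ⟨t, ht⟩ | ⟨u, v, huv, hv⟩
  · exact exists_retraction_of_section i p w hi ex t ht
  exfalso
  have h1 : (i ≫ u) ≫ cokernel.π κ + i ≫ v = 0 := by
    have := w
    rw [huv, Preadditive.comp_add] at this
    simpa using this
  have h2 : i ≫ u = 0 := by
    apply hX
    intro he
    have h3 : i ≫ v = (i ≫ (-u)) ≫ cokernel.π κ := by
      rw [add_comm, add_eq_zero_iff_eq_neg] at h1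
      simpa using h1
    have : Epi (i ≫ (-u)) := by
      rw [Preadditive.comp_neg]; infer_instance
    have : Epi (i ≫ v) := by rw [h3]; exact epi_comp _ _
    exact hv (epi_of_epi i v)
  have h3 : i ≫ v = 0 := by simpa [h2] using h1
  obtain ⟨u', hu'⟩ := ex.desc' u h2
  obtain ⟨v', hv'⟩ := ex.desc' v h3
  dsimp at u' v' hu' hv'
  have h4 : u' ≫ cokernel.π κ + v' = 𝟙 _ := by
    rw [← cancel_epi p, Preadditive.comp_add, reassoc_of% hu', hv', ← huv, Category.comp_id]
  have hv'e : ¬ Epi v' := by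
    intro h
    apply hv
    rw [← hv']; exact epi_comp _ _
  have h5 : Epi (biprod.desc (u' ≫ cokernel.π κ) v') := by
    have : biprod.lift (𝟙 _) (𝟙 _) ≫ biprod.desc (u' ≫ cokernel.π κ) v' = 𝟙 _ := by
      simpa using h4
    exact epi_of_epi_fac this
  have h6 : Epi (u' ≫ cokernel.π κ) := (hZ.epi_or_epi _ _ h5).resolve_right hv'e
  have h7 : IsIso (u' ≫ cokernel.π κ) := isIso_of_epi_endo k (hfin _ _) _
  rcases retract_indec hE (inv (u' ≫ cokernel.π κ) ≫ u') (cokernel.π κ)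
    (by rw [Category.assoc]; exact IsIso.inv_hom_id _) with h | ⟨-, h⟩
  · exact hZ0 h
  · have : κ = 0 := by
      rw [← cancel_mono (cokernel.π κ)]; simp
    apply Simple.not_isZero S
    rw [IsZero.iff_id_eq_zero, ← cancel_mono κ, this]; simp

/-- Compatibility of two members of an exceptional sequence or silting object. -/
def Compat (X Y : A) : Prop :=
  ((∀ f : X ⟶ Y, f = 0) ∧ Ext1IsZero X Y) ∨ ((∀ f : Y ⟶ X, f = 0) ∧ Ext1IsZero Y X) ∨
    (Ext1IsZero X Y ∧ Ext1IsZero Y X)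

/-- The main result: a generating family of pairwise compatible indecomposables contains
a simple object. -/
lemma exists_simple_of_compat (k : Type*) [Field k] [Linear k A]
    (hfin : ∀ X Y : A, FiniteDimensional k (X ⟶ Y))
    (hL : ∀ X : A, WellFoundedGT (Subobject X) ∧ WellFoundedLT (Subobject X))
    (hU : ∀ X : A, Indecomposable X → IsChainObj X) (hH : Hereditary (A := A))
    (hA : ∃ X : A, ¬ IsZero X)
    (F : A → Prop) (hind : ∀ X, F X → Indecomposable X)
    (hcomp : ∀ X Y, F X → F Y → Compat X Y)
    (hgen : ∀ P : A → Prop, ThickClosed (A := A) P → (∀ X, F X → P X) → ∀ X, P X) :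
    ∃ X, F X ∧ Simple X := by
  classical
  have hL' : ∀ X : A, WellFoundedLT (Subobject X) := fun X => (hL X).2
  have hFin : ∀ X, F X → Finite (Subobject X) := by
    intro X hX
    have := (hL X).1
    have := (hL X).2
    exact finite_of_chain (hU X (hind X hX))
  have hme : ∀ X Y, F X → F Y → ∀ f : X ⟶ Y, f ≠ 0 → Mono f ∨ Epi f := by
    intro X Y hX hY f hf
    refine mono_or_epi_of_ext k hH (hfin _ _) (hU X (hind X hX)) (hind Y hY) ?_ f hf
    rcases hcomp X Y hX hY with h | h | h
    · exact absurd (h.1 f) hf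
    · exact h.2
    · exact h.2
  by_contra! hns
  have hne : ∃ X, F X := by
    by_contra! hno
    obtain ⟨X, hX⟩ := hA
    have h0 := hgen _ (thickClosed_perp hH X) (fun Y hY => absurd hY (hno Y)) X
    exact hX ((IsZero.iff_id_eq_zero X).2 (h0.1 _))
  have hex : ∃ n, ∃ X, F X ∧ Nat.card (Subobject X) = n := by
    obtain ⟨X, hX⟩ := hne
    exact ⟨_, X, hX, rfl⟩
  obtain ⟨E, hE, hEn⟩ := Nat.find_spec hex
  have hmin : ∀ X, F X → Nat.card (Subobject E) ≤ Nat.card (Subobject X) := by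
    intro X hX
    rw [hEn]
    exact Nat.find_min' hex ⟨X, hX, rfl⟩
  have hEi := hind E hE
  have := hFin E hE
  have : IsArtinianObject E := ⟨hL' E⟩
  obtain ⟨S, hS⟩ := exists_simple_subobject hEi.1
  let κ := S.arrow
  have hκ : Mono κ := inferInstance
  have hκ0 : κ ≠ 0 := by
    intro h
    apply Simple.not_isZero (S : A)
    rw [IsZero.iff_id_eq_zero, ← cancel_mono κ, h]; simp
  have hZ0 : ¬ IsZero (cokernel κ) := by
    intro h
    have h1 : Epi κ := Preadditive.epi_of_isZero_cokernel κ h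
    have h2 : IsIso κ := isIso_of_mono_of_epi κ
    exact hns E hE (Simple.of_iso (asIso κ).symm)
  have hall := hgen _ (thickClosed_perp hH (cokernel κ)) ?_ (cokernel κ)
  · exact hZ0 ((IsZero.iff_id_eq_zero _).2 (hall.1 _))
  intro X hX
  refine ⟨fun f => ?_, ?_⟩
  · by_contra hf
    have h1 : cokernel.π κ ≫ f ≠ 0 := by
      intro h
      apply hf
      rw [← cancel_epi (cokernel.π κ), h, comp_zero]
    have hnm : ¬ Mono (cokernel.π κ ≫ f) := by
      intro h
      apply hκ0
      rw [← cancel_mono (cokernel.π κ ≫ f)]; simp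
    have he : Epi (cokernel.π κ ≫ f) := (hme E X hE hX _ h1).resolve_left hnm
    exact absurd (hmin X hX) (not_le.2 (card_lt_of_epi _ hnm))
  · refine ext_zero_of_no_map k hfin hL' hU hEi hS κ hκ hZ0 X (fun f hf => ?_)
    by_contra hf0
    have hm : Mono f := (hme X E hX hE f hf0).resolve_right hf
    exact absurd (hmin X hX) (not_le.2 (card_lt_of_mono f hf))

lemma indecomposable_of_finrank_one (k : Type*) [Field k] [Linear k A] {X : A}
    (h : Module.finrank k (X ⟶ X) = 1) : Indecomposable X := by
  have hX : ¬ IsZero X := by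
    intro hz
    have : Subsingleton (X ⟶ X) := ⟨fun a b => hz.eq_of_src _ _⟩
    rw [Module.finrank_zero_of_subsingleton] at h
    exact zero_ne_one h
  refine ⟨hX, fun Y Z e => ?_⟩
  have h1 : (𝟙 X) ≠ 0 := fun h => hX ((IsZero.iff_id_eq_zero X).2 h)
  obtain ⟨c, hc⟩ := (finrank_eq_one_iff_of_nonzero' (𝟙 X) h1).1 h
    (e.hom ≫ biprod.fst ≫ biprod.inl ≫ e.inv)
  by_cases hc0 : c = 0
  · left
    have h2 := congrArg (fun t => biprod.inl ≫ e.inv ≫ t ≫ e.hom ≫ biprod.fst) hc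
    rw [IsZero.iff_id_eq_zero]
    simpa [hc0] using h2.symm
  · right
    have h2 := congrArg (fun t => biprod.inr ≫ e.inv ≫ t ≫ e.hom ≫ biprod.snd) hc
    rw [IsZero.iff_id_eq_zero]
    simpa [hc0] using h2

/-- A thick predicate containing all indecomposable summands of `Y` contains `Y`. -/
lemma thick_of_summands (hL : ∀ X : A, WellFoundedLT (Subobject X)) {P : A → Prop}
    (hP : ThickClosed (A := A) P) (Y : A) :
    (∀ X, Indecomposable X → (∃ (s : X ⟶ Y) (r : Y ⟶ X), s ≫ r = 𝟙 X) → P X) → P Y := by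
  induction Y using decomp_induction hL with
  | h0 X hX => exact fun _ => hP.1 X hX
  | h1 X hX => exact fun h => h X hX ⟨𝟙 X, 𝟙 X, by simp⟩
  | h2 X Y W e hY hW =>
    intro h
    have h1 : P Y := hY (fun T hT ⟨s, r, hsr⟩ => h T hT
      ⟨s ≫ biprod.inl ≫ e.inv, e.hom ≫ biprod.fst ≫ r, by simp [hsr]⟩)
    have h2 : P W := hW (fun T hT ⟨s, r, hsr⟩ => h T hT
      ⟨s ≫ biprod.inr ≫ e.inv, e.hom ≫ biprod.snd ≫ r, by simp [hsr]⟩)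
    have h3 : P (Y ⊞ W) := hP.2.2.2.2.1 Y (Y ⊞ W) W biprod.inl biprod.snd (by simp)
      inferInstance inferInstance
      (ShortComplex.Splitting.ofHasBinaryBiproduct Y W).exact h1 h2
    exact hP.2.1 _ _ e.symm h3

end Helpers

/-- Every full exceptional sequence in `mod kA_s` contains a simple module, and every
silting object in `D^b(mod kA_s)` contains a shift of a simple module as a direct summand
(a silting object in the bounded derived category of the hereditary category `mod kA_s` is
encoded by its cohomology modules `M i` placed in degrees `-n i`, subject to the silting
vanishing conditions and to classical generation). -/
theorem modA_exceptional_sequence_and_silting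
    (s : ℕ) (hs : 0 < s) (MD : ModAData k s A) :
    -- every full exceptional sequence in `mod kA_s` contains a simple module
    (∀ (n : ℕ) (E : Fin n → A),
      (∀ i, Module.finrank k (E i ⟶ E i) = 1) →
      (∀ i, Ext1IsZero (A := A) (E i) (E i)) →
      (∀ i j : Fin n, (j : ℕ) < (i : ℕ) →
        (∀ f : E i ⟶ E j, f = 0) ∧ Ext1IsZero (A := A) (E i) (E j)) →
      (∀ P : A → Prop, ThickClosed (A := A) P → (∀ i, P (E i)) → ∀ X, P X) →
      ∃ i, Simple (E i)) ∧
    -- every silting object in `D^b(mod kA_s)` contains a shift of a simple module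
    -- as a direct summand
    (∀ (m : ℕ) (M : Fin m → A) (sh : Fin m → ℤ),
      (∀ i, ¬ IsZero (M i)) →
      (∀ i j : Fin m, sh j < sh i → ∀ f : M i ⟶ M j, f = 0) →
      (∀ i j : Fin m, sh j ≤ sh i → Ext1IsZero (A := A) (M i) (M j)) →
      (∀ P : A → Prop, ThickClosed (A := A) P → (∀ i, P (M i)) → ∀ X, P X) →
      ∃ (i : Fin m) (S : A), Simple S ∧
        ∃ (r : M i ⟶ S) (t : S ⟶ M i), t ≫ r = 𝟙 S) := by
  have hL' : ∀ X : A, WellFoundedLT (Subobject X) := fun X => (MD.finiteLength X).2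
  have hA : ∃ X : A, ¬ IsZero X :=
    have := MD.simple_simples ⟨0, hs⟩
    ⟨MD.simples ⟨0, hs⟩, Simple.not_isZero _⟩
  constructor
  · intro n E hfr hself hexc hgen
    obtain ⟨X, ⟨i, rfl⟩, hX⟩ := exists_simple_of_compat k MD.homFinite MD.finiteLength
      MD.uniserial MD.hereditary hA (fun X => ∃ i, E i = X)
      (by rintro X ⟨i, rfl⟩; exact indecomposable_of_finrank_one k (hfr i))
      (by
        rintro X Y ⟨i, rfl⟩ ⟨j, rfl⟩
        rcases lt_trichotomy (i : ℕ) (j : ℕ) with h | h | h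
        · exact Or.inr (Or.inl (hexc j i h))
        · obtain rfl := Fin.ext h
          exact Or.inr (Or.inr ⟨hself i, hself i⟩)
        · exact Or.inl (hexc i j h))
      (fun P hP h => hgen P hP (fun i => h _ ⟨i, rfl⟩))
    exact ⟨i, hX⟩
  · intro m M sh _ hhom hext hgen
    obtain ⟨X, ⟨hXi, i, s, r, hsr⟩, hX⟩ := exists_simple_of_compat k MD.homFinite MD.finiteLength
      MD.uniserial MD.hereditary hA
      (fun X => Indecomposable X ∧ ∃ (i : Fin m) (s : X ⟶ M i) (r : M i ⟶ X), s ≫ r = 𝟙 X)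
      (fun X hX => hX.1)
      (by
        rintro X Y ⟨-, i, s, r, hsr⟩ ⟨-, j, s', r', hsr'⟩
        have key : ∀ {X Y : A} (i j : Fin m) (s : X ⟶ M i) (r : M i ⟶ X) (s' : Y ⟶ M j)
            (r' : M j ⟶ Y), s ≫ r = 𝟙 X → s' ≫ r' = 𝟙 Y → sh j < sh i →
            ∀ f : X ⟶ Y, f = 0 := by
          intro X Y i j s r s' r' h1 h2 hlt f
          have h3 : f = s ≫ (r ≫ f ≫ s') ≫ r' := by
            simp [h2, reassoc_of% h1]
          rw [h3, hhom i j hlt (r ≫ f ≫ s')]; simp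
        have key2 : ∀ {X Y : A} (i j : Fin m) (s : X ⟶ M i) (r : M i ⟶ X) (s' : Y ⟶ M j)
            (r' : M j ⟶ Y), s ≫ r = 𝟙 X → s' ≫ r' = 𝟙 Y → sh j ≤ sh i → Ext1IsZero X Y :=
          fun i j s r s' r' h1 h2 hle =>
            ((hext i j hle).retract_left s r h1).retract_right s' r' h2
        rcases lt_trichotomy (sh i) (sh j) with h | h | h
        · exact Or.inr (Or.inl ⟨key j i s' r' s r hsr' hsr h,
            key2 j i s' r' s r hsr' hsr h.le⟩)
        · exact Or.inr (Or.inr ⟨key2 i j s r s' r' hsr hsr' h.ge,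
            key2 j i s' r' s r hsr' hsr h.le⟩)
        · exact Or.inl ⟨key i j s r s' r' hsr hsr' h, key2 i j s r s' r' hsr hsr' h.le⟩)
      (fun P hP h => hgen P hP (fun i => thick_of_summands hL' hP (M i)
        (fun X hX ⟨s, r, hsr⟩ => h X ⟨hX, i, s, r, hsr⟩)))
    exact ⟨i, X, hX, r, s, hsr⟩
end

section
/- Let A_t be the category of finite-dimensional nilpotent representations of the cyclic quiver with t vertices over a field k, and let (T, F) be a torsion pair in A_t. Then exactly one of the following holds: (1) T is a tilting torsion class, equivalently T contains a non-exceptional indecomposable object; (2) F is a cotilting torsion-free class, equivalently F contains a non-exceptional indecomposable object. -/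
open CategoryTheory CategoryTheory.Limits

universe v u

variable (k : Type*) [Field k]

/-- The `n`-fold composition of an endofunctor. -/
def fpow {A : Type u} [Category.{v} A] (F : A ⥤ A) : ℕ → A ⥤ A
  | 0 => 𝟭 A
  | n + 1 => fpow F n ⋙ F

/-- Data exhibiting an abelian category `A` as `A_t = nilp kÃ_{t-1}`, the category of
finite-dimensional nilpotent representations of the cyclic quiver with `t` vertices over a
field `k`: a Hom-finite uniserial length `k`-category equipped with an autoequivalence `τ`
of period `t` realizing Serre duality `Ext¹(X, Y) ≅ D Hom(Y, τ X)` (in the form of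
simultaneous vanishing), and whose simple objects form a single `τ`-orbit of size `t`. -/
structure NilpTubeData (t : ℕ) (A : Type u) [Category.{v} A] [Abelian A] [Linear k A] where
  homFinite : ∀ X Y : A, FiniteDimensional k (X ⟶ Y)
  finiteLength : ∀ X : A, WellFoundedGT (Subobject X) ∧ WellFoundedLT (Subobject X)
  uniserial : ∀ X : A, Indecomposable X → ∀ a b : Subobject X, a ≤ b ∨ b ≤ a
  tau : A ≌ A
  serre : ∀ X Y : A, Ext1IsZero (A := A) X Y ↔ ∀ f : Y ⟶ tau.functor.obj X, f = 0
  tau_period : Nonempty (fpow tau.functor t ≅ 𝟭 A)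
  S₀ : A
  simple_S₀ : Simple S₀
  simples_orbit : ∀ S : A, Simple S → ∃ i : Fin t, Nonempty (S ≅ (fpow tau.functor i).obj S₀)
  orbit_distinct : ∀ i j : Fin t,
    Nonempty ((fpow tau.functor i).obj S₀ ≅ (fpow tau.functor j).obj S₀) → i = j

section AuxPart

namespace TubeAux

set_option linter.unusedSectionVars false

section Aux

variable {A : Type u} [Category.{v} A] [Abelian A]

/-- Chain condition: the subobjects are totally ordered. -/
def Ch (X : A) : Prop := ∀ a b : Subobject X, a ≤ b ∨ b ≤ a

/-- Composition length of an object with totally ordered finite subobject lattice. -/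
noncomputable def len (X : A) : ℕ := Nat.card (Subobject X) - 1

lemma map_le {Y Z : A} (i : Y ⟶ Z) [Mono i] (a : Subobject Y) :
    (Subobject.map i).obj a ≤ Subobject.mk i := by
  induction a using Subobject.ind with
  | _ f =>
    rw [Subobject.map_mk]
    exact Subobject.mk_le_mk_of_comm f rfl

lemma exists_map_eq {Y Z : A} (i : Y ⟶ Z) [Mono i] (a : Subobject Z)
    (h : a ≤ Subobject.mk i) : ∃ b, (Subobject.map i).obj b = a := by
  induction a using Subobject.ind with
  | _ f =>
    have hm : Mono (Subobject.ofMkLEMk f i h) :=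
      mono_of_mono_fac (Subobject.ofMkLEMk_comp h)
    refine ⟨Subobject.mk (Subobject.ofMkLEMk f i h), ?_⟩
    rw [Subobject.map_mk]
    simp

lemma map_le_iff {Y Z : A} (i : Y ⟶ Z) [Mono i] (a b : Subobject Y) :
    (Subobject.map i).obj a ≤ (Subobject.map i).obj b ↔ a ≤ b := by
  constructor
  · intro h
    induction a using Subobject.ind with
    | _ f =>
    induction b using Subobject.ind with
    | _ g =>
    rw [Subobject.map_mk, Subobject.map_mk] at h
    refine Subobject.mk_le_mk_of_comm (Subobject.ofMkLEMk _ _ h) ?_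
    rw [← cancel_mono i, Category.assoc, Subobject.ofMkLEMk_comp h]
  · intro h
    exact (Subobject.map i).monotone h

/-- Subobjects of a subobject. -/
noncomputable def iicIso {Y Z : A} (i : Y ⟶ Z) [Mono i] :
    Subobject Y ≃o Set.Iic (Subobject.mk i) where
  toEquiv := Equiv.ofBijective
    (fun a => ⟨(Subobject.map i).obj a, map_le i a⟩) (by
      constructor
      · intro a b h
        exact Subobject.map_obj_injective i (congrArg Subtype.val h)
      · rintro ⟨a, ha⟩
        obtain ⟨b, hb⟩ := exists_map_eq i a ha
        exact ⟨b, Subtype.ext hb⟩)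
  map_rel_iff' := by
    intro a b
    exact map_le_iff i a b

open Opposite in
lemma subIso_mk {X K W : A} (i : K ⟶ X) (p : X ⟶ W) (w : i ≫ p = 0) [Mono i] [Epi p]
    (he : (ShortComplex.mk i p w).Exact) :
    Abelian.subobjectIsoSubobjectOp X (Subobject.mk i) = OrderDual.toDual (Subobject.mk p.op) := by
  change Subobject.mk (cokernel.π i).op = Subobject.mk p.op
  have hc : IsColimit (CokernelCofork.ofπ p w) := he.gIsCokernel
  refine Subobject.mk_eq_mk_of_comm _ _
    (Iso.op (hc.coconePointUniqueUpToIso (colimit.isColimit _))) ?_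
  apply Quiver.Hom.unop_inj
  exact hc.comp_coconePointUniqueUpToIso_hom (colimit.isColimit _) WalkingParallelPair.one

lemma ch_op {X : A} (h : Ch X) : Ch (Opposite.op X) := by
  intro a b
  have e := (Abelian.subobjectIsoSubobjectOp X)
  have := h (e.symm (OrderDual.toDual a)) (e.symm (OrderDual.toDual b))
  simpa [or_comm] using this

lemma ch_of_op {X : A} (h : Ch (Opposite.op X)) : Ch X := by
  intro a b
  have e := (Abelian.subobjectIsoSubobjectOp X)
  have := h (OrderDual.ofDual (e a)) (OrderDual.ofDual (e b))
  simpa [or_comm] using this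

lemma ch_mono {Y Z : A} (i : Y ⟶ Z) [Mono i] (h : Ch Z) : Ch Y := by
  intro a b
  have := h ((Subobject.map i).obj a) ((Subobject.map i).obj b)
  simpa [map_le_iff] using this

lemma ch_epi {Y Z : A} (p : Y ⟶ Z) [Epi p] (h : Ch Y) : Ch Z :=
  ch_of_op (ch_mono p.op (ch_op h))

lemma finite_of_ch {X : A} (h : Ch X)
    (hf : WellFoundedGT (Subobject X) ∧ WellFoundedLT (Subobject X)) :
    Finite (Subobject X) := by
  classical
  obtain ⟨h1, h2⟩ := hf
  let _ : LinearOrder (Subobject X) :=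
    { (inferInstance : PartialOrder (Subobject X)) with
      le_total := h
      toDecidableLE := Classical.decRel _
      min := fun a b => if a ≤ b then a else b
      max := fun a b => if a ≤ b then b else a
      min_def := fun a b => by congr
      max_def := fun a b => by congr }
  exact Finite.of_wellFoundedLT_wellFoundedGT _

lemma card_op (X : A) : Nat.card (Subobject (Opposite.op X)) = Nat.card (Subobject X) :=
  Nat.card_congr ((Abelian.subobjectIsoSubobjectOp X).toEquiv.trans OrderDual.ofDual).symm

lemma card_mono {Y Z : A} (i : Y ⟶ Z) [Mono i] :
    Nat.card (Subobject Y) = Nat.card (Set.Iic (Subobject.mk i)) :=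
  Nat.card_congr (iicIso i).toEquiv

lemma card_iso {Y Z : A} (i : Y ≅ Z) :
    Nat.card (Subobject Y) = Nat.card (Subobject Z) :=
  Nat.card_congr (Subobject.mapIsoToOrderIso i).toEquiv

lemma card_add {X K W : A} (i : K ⟶ X) (p : X ⟶ W) (w : i ≫ p = 0) [Mono i] [Epi p]
    (he : (ShortComplex.mk i p w).Exact) (h : Ch X) [Finite (Subobject X)] :
    Nat.card (Subobject K) + Nat.card (Subobject W) = Nat.card (Subobject X) + 1 := by
  have h1 : Nat.card (Subobject W) = Nat.card (Set.Ici (Subobject.mk i)) := by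
    rw [← card_op, card_mono p.op]
    refine Nat.card_congr ?_
    refine (Equiv.subtypeEquiv ((Abelian.subobjectIsoSubobjectOp X).toEquiv.trans
      OrderDual.ofDual) ?_).symm
    intro a
    have := subIso_mk i p w he
    simp only [Set.mem_Ici, Set.mem_Iic]
    rw [← (Abelian.subobjectIsoSubobjectOp X).le_iff_le, this]
    rfl
  rw [h1, card_mono i, Nat.card_coe_set_eq, Nat.card_coe_set_eq, ← Set.ncard_union_add_ncard_inter,
    Set.Iic_inter_Ici, Set.Icc_self, Set.ncard_singleton]
  have : Set.Iic (Subobject.mk i) ∪ Set.Ici (Subobject.mk i) = Set.univ := by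
    ext a
    simpa using h a _
  rw [this, Set.ncard_univ]

lemma card_pos' (X : A) [Finite (Subobject X)] : 0 < Nat.card (Subobject X) := Nat.card_pos

lemma len_add {X K W : A} (i : K ⟶ X) (p : X ⟶ W) (w : i ≫ p = 0) [Mono i] [Epi p]
    (he : (ShortComplex.mk i p w).Exact) (h : Ch X)
    (hf : WellFoundedGT (Subobject X) ∧ WellFoundedLT (Subobject X)) :
    len K + len W = len X := by
  have := finite_of_ch h hf
  have h1 := card_add i p w he h
  have : Finite (Subobject K) := Finite.of_equiv _ (iicIso i).toEquiv.symm
  have : Finite (Subobject (Opposite.op X)) :=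
    Finite.of_equiv _ ((Abelian.subobjectIsoSubobjectOp X).toEquiv.trans OrderDual.ofDual)
  have : Finite (Subobject (Opposite.op W)) := Finite.of_equiv _ (iicIso p.op).toEquiv.symm
  have : Finite (Subobject W) :=
    Finite.of_equiv _ ((Abelian.subobjectIsoSubobjectOp W).toEquiv.trans OrderDual.ofDual).symm
  have := card_pos' K
  have := card_pos' W
  have := card_pos' X
  unfold len
  omega

lemma len_iso {X Y : A} (i : X ≅ Y) : len X = len Y := by
  unfold len
  rw [card_iso i]

lemma len_zero {X : A} (h : IsZero X) : len X = 0 := by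
  have : Subsingleton (Subobject X) := by
    constructor
    intro a b
    induction a using Subobject.ind with
    | _ f =>
    induction b using Subobject.ind with
    | _ g =>
    rw [Subobject.mk_eq_bot_iff_zero.2 (h.eq_of_tgt f 0),
      Subobject.mk_eq_bot_iff_zero.2 (h.eq_of_tgt g 0)]
  unfold len
  rw [Nat.card_unique]

lemma len_pos {X : A} (h : ¬ IsZero X) (hc : Ch X)
    (hf : WellFoundedGT (Subobject X) ∧ WellFoundedLT (Subobject X)) : 0 < len X := by
  have := finite_of_ch hc hf
  have := Subobject.nontrivial_of_not_isZero h
  have := Finite.one_lt_card (α := Subobject X)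
  unfold len
  omega

lemma len_simple (S : A) [Simple S] : len S = 1 := by
  classical
  unfold len
  have := Nat.card_congr (IsSimpleOrder.equivBool (α := Subobject S))
  rw [this]
  simp

lemma ch_simple (S : A) [Simple S] : Ch S := by
  intro a b
  rcases eq_bot_or_eq_top a with rfl | rfl
  · left; simp
  · right; simp

/-- Two epimorphisms from a chain object are comparable. -/
lemma epi_comp {X Y Z : A} (h : Ch X) (g : X ⟶ Y) (g' : X ⟶ Z) [Epi g] [Epi g'] :
    (∃ e : Y ⟶ Z, g ≫ e = g') ∨ (∃ e : Z ⟶ Y, g' ≫ e = g) := by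
  rcases h (Subobject.mk (kernel.ι g)) (Subobject.mk (kernel.ι g')) with h | h
  · left
    refine ⟨Abelian.epiDesc g g' ?_, Abelian.comp_epiDesc _ _ _⟩
    rw [← Subobject.ofMkLEMk_comp h, Category.assoc, kernel.condition, comp_zero]
  · right
    refine ⟨Abelian.epiDesc g' g ?_, Abelian.comp_epiDesc _ _ _⟩
    rw [← Subobject.ofMkLEMk_comp h, Category.assoc, kernel.condition, comp_zero]

lemma indec_of_ch {X : A} (h0 : ¬ IsZero X) (h : Ch X) : Indecomposable X := by
  refine ⟨h0, fun Y Z e => ?_⟩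
  have h' : Ch (Y ⊞ Z) := ch_mono e.inv h
  rcases epi_comp h' (biprod.fst : Y ⊞ Z ⟶ Y) (biprod.snd : Y ⊞ Z ⟶ Z) with ⟨q, hq⟩ | ⟨q, hq⟩
  · right
    rw [IsZero.iff_id_eq_zero]
    have := congrArg (fun f => biprod.inr ≫ f) hq
    simpa using this.symm
  · left
    rw [IsZero.iff_id_eq_zero]
    have := congrArg (fun f => biprod.inl ≫ f) hq
    simpa using this.symm

end Aux

end TubeAux

namespace TubeAux

/-- Cleaned-up tube data, formulated self-dually. -/
structure TD (t : ℕ) (A : Type u) [Category.{v} A] [Abelian A] where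
  ht : 0 < t
  fl : ∀ X : A, WellFoundedGT (Subobject X) ∧ WellFoundedLT (Subobject X)
  un : ∀ X : A, Indecomposable X → Ch X
  tau : A ≌ A
  serre : ∀ X Y : A, Ext1IsZero X Y ↔ ∀ f : Y ⟶ tau.functor.obj X, f = 0
  S₀ : A
  simple_S₀ : Simple S₀
  orbit : ∀ S S' : A, Simple S → Simple S' →
    ∃ i < t, Nonempty (S' ≅ (tau.functor.obj)^[i] S)
  free : ∀ S : A, Simple S → ∀ m, 0 < m → Nonempty (S ≅ (tau.functor.obj)^[m] S) → t ≤ m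

section Decomp

variable {A : Type u} [Category.{v} A] [Abelian A]

/-- Induction along decompositions into indecomposables. -/
lemma decomp (fl : ∀ X : A, WellFoundedGT (Subobject X) ∧ WellFoundedLT (Subobject X))
    (P : A → Prop) (iso : ∀ X Y, (X ≅ Y) → P X → P Y) (zero : ∀ X, IsZero X → P X)
    (ind : ∀ X, Indecomposable X → P X) (bip : ∀ X Y, P X → P Y → P (X ⊞ Y)) (X : A) : P X := by
  by_contra hX
  obtain ⟨-, h2⟩ := fl X
  let s : Set (Subobject X) := {a | ¬ P (a : A)}
  have hs : s.Nonempty := by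
    refine ⟨⊤, fun h => hX (iso _ _ (asIso (⊤ : Subobject X).arrow) h)⟩
  obtain ⟨a, ha, hmin⟩ := h2.wf.has_min s hs
  have key : ∀ (Y : A) (i : Y ⟶ (a : A)), Mono i → ¬ P Y → IsIso i := by
    intro Y i hi hY
    by_contra hni
    refine hmin (Subobject.mk (i ≫ a.arrow)) ?_ ?_
    · intro h
      exact hY (iso _ _ (Subobject.underlyingIso (i ≫ a.arrow)) h)
    · refine lt_of_le_of_ne ?_ ?_
      · exact Subobject.mk_le_of_comm i rfl
      · intro he
        apply hni
        have h1 : a ≤ Subobject.mk (i ≫ a.arrow) := he.ge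
        have h2 : (Subobject.ofLEMk a _ h1) ≫ i = 𝟙 _ := by
          rw [← cancel_mono a.arrow, Category.assoc, Subobject.ofLEMk_comp h1, Category.id_comp]
        have : Epi i := epi_of_epi_fac h2
        exact isIso_of_mono_of_epi i
  by_cases h0 : IsZero (a : A)
  · exact ha (zero _ h0)
  by_cases hi : Indecomposable (a : A)
  · exact ha (ind _ hi)
  have : ∃ Y Z : A, ∃ _ : (a : A) ≅ Y ⊞ Z, ¬ IsZero Y ∧ ¬ IsZero Z := by
    by_contra hcon
    push Not at hcon
    refine hi ⟨h0, fun Y Z e => ?_⟩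
    by_cases hY : IsZero Y
    · exact Or.inl hY
    · exact Or.inr (hcon Y Z e hY)
  obtain ⟨Y, Z, e, hY, hZ⟩ := this
  have hPY : P Y := by
    by_contra hn
    have := key Y (biprod.inl ≫ e.inv) inferInstance hn
    have : IsIso (biprod.inl : Y ⟶ Y ⊞ Z) := IsIso.of_isIso_comp_right _ e.inv
    exact hZ ((Biprod.isIso_inl_iff_isZero Y Z).1 this)
  have hPZ : P Z := by
    by_contra hn
    have := key Z (biprod.inr ≫ e.inv) inferInstance hn
    have h3 : IsIso (biprod.inr : Z ⟶ Y ⊞ Z) := IsIso.of_isIso_comp_right _ e.inv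
    apply hY
    rw [IsZero.iff_id_eq_zero]
    have h4 : (biprod.fst : Y ⊞ Z ⟶ Y) = 0 := by
      rw [← cancel_epi (biprod.inr : Z ⟶ Y ⊞ Z)]
      simp
    rw [← biprod.inl_fst (X := Y) (Y := Z), h4, comp_zero]
  exact ha (iso _ _ e.symm (bip _ _ hPY hPZ))

/-- A nonzero map to anything is detected on an indecomposable. -/
lemma detect (fl : ∀ X : A, WellFoundedGT (Subobject X) ∧ WellFoundedLT (Subobject X))
    (X : A) : ∀ (S : A) (g : X ⟶ S), g ≠ 0 →
      ∃ (U : A) (i : U ⟶ X), Indecomposable U ∧ i ≫ g ≠ 0 := by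
  refine decomp fl (fun X => ∀ (S : A) (g : X ⟶ S), g ≠ 0 →
      ∃ (U : A) (i : U ⟶ X), Indecomposable U ∧ i ≫ g ≠ 0) ?_ ?_ ?_ ?_ X
  · intro X Y e h S g hg
    obtain ⟨U, i, hU, hi⟩ := h S (e.hom ≫ g) (by simpa using hg)
    exact ⟨U, i ≫ e.hom, hU, by simpa using hi⟩
  · intro X hX S g hg
    exact absurd (hX.eq_of_src g 0) hg
  · intro X hX S g hg
    exact ⟨X, 𝟙 X, hX, by simpa using hg⟩
  · intro X Y hX hY S g hg
    by_cases h1 : biprod.inl ≫ g = 0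
    · by_cases h2 : biprod.inr ≫ g = 0
      · exact absurd (biprod.hom_ext' _ _ (by simpa using h1) (by simpa using h2)) hg
      · obtain ⟨U, i, hU, hi⟩ := hY S _ h2
        exact ⟨U, i ≫ biprod.inr, hU, by simpa using hi⟩
    · obtain ⟨U, i, hU, hi⟩ := hX S _ h1
      exact ⟨U, i ≫ biprod.inl, hU, by simpa using hi⟩

/-- A mono from a chain object stays mono after projecting to an indecomposable quotient. -/
lemma mono_detect (fl : ∀ X : A, WellFoundedGT (Subobject X) ∧ WellFoundedLT (Subobject X))
    {X : A} (hX0 : ¬ IsZero X) (hX : Ch X) (Z : A) : ∀ (f : X ⟶ Z), Mono f →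
      ∃ (Q : A) (p : Z ⟶ Q), Indecomposable Q ∧ Epi p ∧ Mono (f ≫ p) := by
  refine decomp fl (fun Z => ∀ (f : X ⟶ Z), Mono f →
      ∃ (Q : A) (p : Z ⟶ Q), Indecomposable Q ∧ Epi p ∧ Mono (f ≫ p)) ?_ ?_ ?_ ?_ Z
  · intro Z W e h f hf
    obtain ⟨Q, p, hQ, hp, hm⟩ := h (f ≫ e.inv) inferInstance
    exact ⟨Q, e.inv ≫ p, hQ, inferInstance, by simpa using hm⟩
  · intro Z hZ f hf
    exact absurd (IsZero.of_mono f hZ) hX0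
  · intro Z hZ f hf
    exact ⟨Z, 𝟙 Z, hZ, inferInstance, by simpa using hf⟩
  · intro Y Z hY hZ f hf
    have key : Mono (f ≫ biprod.fst) ∨ Mono (f ≫ biprod.snd) := by
      rcases hX (Subobject.mk (kernel.ι (f ≫ biprod.fst)))
        (Subobject.mk (kernel.ι (f ≫ biprod.snd))) with h | h
      · left
        apply Preadditive.mono_of_kernel_zero
        have h2 : kernel.ι (f ≫ biprod.fst) ≫ f ≫ biprod.snd = 0 := by
          rw [← Subobject.ofMkLEMk_comp h, Category.assoc, kernel.condition, comp_zero]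
        have h1 := kernel.condition (f ≫ biprod.fst)
        rw [← cancel_mono f]
        apply biprod.hom_ext <;> simpa using by assumption
      · right
        apply Preadditive.mono_of_kernel_zero
        have h2 : kernel.ι (f ≫ biprod.snd) ≫ f ≫ biprod.fst = 0 := by
          rw [← Subobject.ofMkLEMk_comp h, Category.assoc, kernel.condition, comp_zero]
        have h1 := kernel.condition (f ≫ biprod.snd)
        rw [← cancel_mono f]
        apply biprod.hom_ext <;> simpa using by assumption
    rcases key with h | h
    · obtain ⟨Q, p, hQ, hp, hm⟩ := hY _ h
      exact ⟨Q, biprod.fst ≫ p, hQ, epi_comp' inferInstance hp, by simpa using hm⟩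
    · obtain ⟨Q, p, hQ, hp, hm⟩ := hZ _ h
      exact ⟨Q, biprod.snd ≫ p, hQ, epi_comp' inferInstance hp, by simpa using hm⟩

open Opposite in
/-- Nonzero objects have simple quotients. -/
lemma exists_top (fl : ∀ X : A, WellFoundedGT (Subobject X) ∧ WellFoundedLT (Subobject X))
    {X : A} (h0 : ¬ IsZero X) : ∃ (S : A) (g : X ⟶ S), Simple S ∧ Epi g := by
  have h1 := (fl X).1
  have : WellFoundedLT (Subobject (op X)) := by
    have e := (Abelian.subobjectIsoSubobjectOp X)
    have : WellFoundedGT (Subobject (op X))ᵒᵈ := e.symm.toOrderEmbedding.wellFoundedGT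
    exact ⟨this.wf⟩
  have : IsArtinianObject (op X) := ⟨this⟩
  obtain ⟨S, hS⟩ := exists_simple_subobject (X := op X) (fun h => h0 (by simpa using h.unop))
  have := hS
  refine ⟨unop (S : Aᵒᵖ), S.arrow.unop, ?_, inferInstance⟩
  apply simple_of_cosimple
  intro Z f hf
  rw [← isIso_op_iff, Simple.mono_isIso_iff_nonzero]
  refine not_congr ⟨fun h => Quiver.Hom.op_inj (by rw [h, op_zero]), fun h => by rw [h, op_zero]⟩

/-- Indecomposables with the same top are comparable. -/
lemma same_top (fl : ∀ X : A, WellFoundedGT (Subobject X) ∧ WellFoundedLT (Subobject X))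
    (un : ∀ X : A, Indecomposable X → Ch X) {X Y S : A} [Simple S]
    (hX : Indecomposable X) (hY : Indecomposable Y) (g : X ⟶ S) (h : Y ⟶ S) [Epi g] [Epi h] :
    (∃ q : X ⟶ Y, Epi q) ∨ (∃ q : Y ⟶ X, Epi q) := by
  have aux : ∀ {X U : A} (g : X ⟶ S) (f : U ⟶ X), Ch X → f ≫ g ≠ 0 → Epi f := by
    intro X U g f hX hfg
    have : Epi (f ≫ g) := epi_of_nonzero_to_simple hfg
    apply Preadditive.epi_of_cokernel_zero
    by_contra hne
    have hC : ¬ IsZero (cokernel f) := fun h => hne (h.eq_of_tgt _ _)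
    have hg : Epi g := epi_of_epi f g
    rcases epi_comp hX g (cokernel.π f) with ⟨e, he⟩ | ⟨e, he⟩
    · apply hne
      rw [← he]
      have : f ≫ g ≫ e = 0 := by rw [he, cokernel.condition]
      rw [← Category.assoc, ← comp_zero (f := f ≫ g), cancel_epi] at this
      rw [this, comp_zero]
    · apply hfg
      rw [← he, cokernel.condition_assoc, zero_comp]
  have hp : pullback.fst g h ≫ g ≠ 0 := by
    intro h0
    have := epi_comp' (f := pullback.fst g h) (g := g) inferInstance inferInstance
    rw [h0] at this
    exact Simple.not_isZero S (IsZero.of_epi_zero (pullback g h) S)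
  obtain ⟨U, i, hU, hi⟩ := detect fl _ _ _ hp
  have e1 : Epi (i ≫ pullback.fst g h) := aux g _ (un _ hX) (by simpa using hi)
  have e2 : Epi (i ≫ pullback.snd g h) := aux h _ (un _ hY) (by
    rw [pullback.condition] at hi
    simpa using hi)
  rcases epi_comp (un _ hU) (i ≫ pullback.fst g h) (i ≫ pullback.snd g h) with ⟨e, he⟩ | ⟨e, he⟩
  · exact Or.inl ⟨e, epi_of_epi_fac he⟩
  · exact Or.inr ⟨e, epi_of_epi_fac he⟩

lemma top_unique {X S S' : A} [Simple S] [Simple S'] (hX : Ch X) (g : X ⟶ S) (g' : X ⟶ S')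
    [Epi g] [Epi g'] : Nonempty (S ≅ S') := by
  rcases epi_comp hX g g' with ⟨e, he⟩ | ⟨e, he⟩
  · have : Epi e := epi_of_epi_fac he
    have hne : e ≠ 0 := by
      rintro rfl
      exact Simple.not_isZero S' (IsZero.of_epi_zero S S')
    have := isIso_of_epi_of_nonzero hne
    exact ⟨asIso e⟩
  · have : Epi e := epi_of_epi_fac he
    have hne : e ≠ 0 := by
      rintro rfl
      exact Simple.not_isZero S (IsZero.of_epi_zero S' S)
    have := isIso_of_epi_of_nonzero hne
    exact ⟨(asIso e).symm⟩

end Decomp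

end TubeAux

namespace TubeAux

namespace TD

variable {A : Type u} [Category.{v} A] [Abelian A] {t : ℕ} (D : TD t A)

include D

lemma ind_mono {Y Z : A} (i : Y ⟶ Z) [Mono i] (h0 : ¬ IsZero Y) (h : Indecomposable Z) :
    Indecomposable Y := indec_of_ch h0 (ch_mono i (D.un _ h))

lemma ind_epi {Y Z : A} (i : Y ⟶ Z) [Epi i] (h0 : ¬ IsZero Z) (h : Indecomposable Y) :
    Indecomposable Z := indec_of_ch h0 (ch_epi i (D.un _ h))

lemma len_kernel {X W : A} (p : X ⟶ W) [Epi p] (h : Ch X) :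
    len (kernel p) + len W = len X :=
  len_add (kernel.ι p) p (kernel.condition p)
    (ShortComplex.exact_of_f_is_kernel _ (kernelIsKernel p)) h (D.fl X)

lemma len_cokernel {X W : A} (p : W ⟶ X) [Mono p] (h : Ch X) :
    len W + len (cokernel p) = len X :=
  len_add p (cokernel.π p) (cokernel.condition p)
    (ShortComplex.exact_of_g_is_cokernel _ (cokernelIsCokernel p)) h (D.fl X)

lemma len_eq_zero {X : A} (h : Ch X) (h0 : len X = 0) : IsZero X := by
  by_contra hn
  have := len_pos hn h (D.fl X)
  omega

lemma iso_of_epi {X W : A} (p : X ⟶ W) [Epi p] (h : Ch X) (hl : len X ≤ len W) : IsIso p := by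
  have h1 := D.len_kernel p h
  have h2 : IsZero (kernel p) := D.len_eq_zero (ch_mono (kernel.ι p) h) (by omega)
  have : Mono p := Preadditive.mono_of_kernel_zero (h2.eq_of_src _ _)
  exact isIso_of_mono_of_epi p

lemma iso_of_mono {X W : A} (p : W ⟶ X) [Mono p] (h : Ch X) (hl : len X ≤ len W) : IsIso p := by
  have h1 := D.len_cokernel p h
  have h2 : IsZero (cokernel p) := D.len_eq_zero (ch_epi (cokernel.π p) h) (by omega)
  have : Epi p := Preadditive.epi_of_cokernel_zero (h2.eq_of_tgt _ _)
  exact isIso_of_mono_of_epi p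

/-- Comparability of subobjects by length. -/
lemma factor {X Y Z : A} (h : Ch X) (i : Y ⟶ X) (j : Z ⟶ X) [Mono i] [Mono j]
    (hl : len Y ≤ len Z) : ∃ e : Y ⟶ Z, e ≫ j = i := by
  rcases h (Subobject.mk i) (Subobject.mk j) with h' | h'
  · exact ⟨Subobject.ofMkLEMk _ _ h', Subobject.ofMkLEMk_comp h'⟩
  · have hc := Subobject.ofMkLEMk_comp h'
    have : Mono (Subobject.ofMkLEMk j i h') := mono_of_mono_fac hc
    have := D.iso_of_mono (Subobject.ofMkLEMk j i h') (ch_mono i h) hl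
    refine ⟨inv (Subobject.ofMkLEMk j i h'), ?_⟩
    rw [IsIso.inv_comp_eq, hc]

lemma simple_tau {S : A} (hS : Simple S) : Simple (D.tau.functor.obj S) :=
  simple_obj D.tau.functor S

lemma simple_iter {S : A} (hS : Simple S) (m : ℕ) : Simple (D.tau.functor.obj^[m] S) := by
  induction m with
  | zero => exact hS
  | succ m ih =>
    rw [Function.iterate_succ_apply']
    exact D.simple_tau ih

lemma rad_top {X S : A} (hX : Indecomposable X) (hS : Simple S) (g : X ⟶ S) [Epi g]
    (h0 : ¬ IsZero (kernel g)) : ∃ h : kernel g ⟶ D.tau.functor.obj S, Epi h := by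
  have hne : ¬ Ext1IsZero S (kernel g) := by
    intro hE
    obtain ⟨r, hr⟩ := hE X (kernel.ι g) g (kernel.condition g) inferInstance inferInstance
      (ShortComplex.exact_of_f_is_kernel _ (kernelIsKernel g))
    have : Epi r := epi_of_epi_fac hr
    rcases epi_comp (D.un _ hX) r g with ⟨e, he⟩ | ⟨e, he⟩
    · have h1 : kernel.ι g ≫ r ≫ e = 0 := by rw [he, kernel.condition]
      rw [← Category.assoc, hr, Category.id_comp] at h1
      rw [h1, comp_zero] at he
      have : Epi (0 : X ⟶ S) := by rw [he]; infer_instance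
      exact Simple.not_isZero S (IsZero.of_epi_zero X S)
    · apply h0
      rw [IsZero.iff_id_eq_zero, ← hr, ← he, kernel.condition_assoc, zero_comp]
  rw [D.serre] at hne
  push Not at hne
  obtain ⟨f, hf⟩ := hne
  have := D.simple_tau hS
  exact ⟨f, epi_of_nonzero_to_simple hf⟩

lemma exists_sub {X S : A} (hX : Indecomposable X) (hS : Simple S) (g : X ⟶ S) [Epi g] (m : ℕ)
    (hm : m < len X) : ∃ (Y : A) (i : Y ⟶ X) (h : Y ⟶ D.tau.functor.obj^[m] S),
      Mono i ∧ Indecomposable Y ∧ len Y + m = len X ∧ Epi h := by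
  induction m with
  | zero => exact ⟨X, 𝟙 X, g, inferInstance, hX, rfl, ‹Epi g›⟩
  | succ m ih =>
    obtain ⟨Y, i, h, hi, hY, hl, hh⟩ := ih (by omega)
    have hS' := D.simple_iter hS m
    have h1 := D.len_kernel h (D.un _ hY)
    have hls := len_simple (D.tau.functor.obj^[m] S)
    rw [hls] at h1
    have h0 : ¬ IsZero (kernel h) := by
      intro h0
      rw [len_zero h0] at h1
      omega
    obtain ⟨r, hr⟩ := D.rad_top hY hS' h h0
    rw [Function.iterate_succ_apply']
    exact ⟨kernel h, kernel.ι h ≫ i, r, mono_comp _ _, D.ind_mono (kernel.ι h) h0 hY,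
      by omega, hr⟩

lemma sub_top {X S Y : A} (hX : Indecomposable X) (hS : Simple S) (g : X ⟶ S) [Epi g]
    (hY : ¬ IsZero Y) (i : Y ⟶ X) [Mono i] :
    ∃ m, len Y + m = len X ∧ ∃ h : Y ⟶ D.tau.functor.obj^[m] S, Epi h := by
  have h1 := D.len_cokernel i (D.un _ hX)
  have h2 := len_pos hY (ch_mono i (D.un _ hX)) (D.fl Y)
  obtain ⟨Z, j, h, hj, hZ, hl, hh⟩ := D.exists_sub hX hS g (len (cokernel i)) (by omega)
  obtain ⟨e, he⟩ := D.factor (D.un _ hX) i j (by omega)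
  have : Mono e := mono_of_mono_fac he
  have := D.iso_of_mono e (D.un _ hZ) (by omega)
  exact ⟨_, h1, e ≫ h, inferInstance⟩

lemma len_tau {X : A} (hX : Indecomposable X) :
    Indecomposable (D.tau.functor.obj X) ∧ len (D.tau.functor.obj X) = len X := by
  have e : Subobject X ≃o Subobject (D.tau.functor.obj X) := by
    have hle : ∀ a b : Subobject X, Subobject.mk (D.tau.functor.map a.arrow) ≤
        Subobject.mk (D.tau.functor.map b.arrow) ↔ a ≤ b := by
      intro a b
      constructor
      · intro h
        refine Subobject.le_of_comm (D.tau.functor.preimage (Subobject.ofMkLEMk _ _ h)) ?_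
        apply D.tau.functor.map_injective
        rw [Functor.map_comp, Functor.map_preimage, Subobject.ofMkLEMk_comp h]
      · intro h
        refine Subobject.mk_le_mk_of_comm (D.tau.functor.map (Subobject.ofLE a b h)) ?_
        rw [← Functor.map_comp, Subobject.ofLE_arrow]
    refine RelIso.ofSurjective (OrderEmbedding.ofMapLEIff
      (fun a : Subobject X => Subobject.mk (D.tau.functor.map a.arrow)) hle) ?_
    intro b
    induction b using Subobject.ind with
    | _ f =>
    rename_i Z _
    let e := D.tau.functor.objObjPreimageIso Z
    let g := D.tau.functor.preimage (e.hom ≫ f)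
    have hg : D.tau.functor.map g = e.hom ≫ f := D.tau.functor.map_preimage _
    have : Mono (D.tau.functor.map g) := by rw [hg]; infer_instance
    have : Mono g := D.tau.functor.mono_of_mono_map this
    refine ⟨Subobject.mk g, ?_⟩
    refine Subobject.mk_eq_mk_of_comm _ _
      (D.tau.functor.mapIso (Subobject.underlyingIso g) ≪≫ e) ?_
    simp only [Iso.trans_hom, Functor.mapIso_hom, Category.assoc]
    rw [← hg, ← Functor.map_comp, Subobject.underlyingIso_hom_comp_eq_mk]
  constructor
  · refine indec_of_ch ?_ ?_
    · intro h
      apply hX.1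
      rw [IsZero.iff_id_eq_zero]
      apply D.tau.functor.map_injective
      exact h.eq_of_src _ _
    · intro a b
      have := D.un _ hX (e.symm a) (e.symm b)
      simpa using this
  · unfold len
    rw [Nat.card_congr e.toEquiv]

lemma full_of_nonexc {X : A} (hX : Indecomposable X) (h : ¬ Ext1IsZero X X) : t ≤ len X := by
  rw [D.serre] at h
  push Not at h
  obtain ⟨f, hf⟩ := h
  obtain ⟨S, g, hS, hg⟩ := exists_top D.fl hX.1
  obtain ⟨h1, h2⟩ := D.len_tau hX
  have hI : ¬ IsZero (Abelian.image f) := by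
    intro h0
    apply hf
    rw [← Abelian.image.fac f, h0.eq_of_tgt (Abelian.factorThruImage f) 0, zero_comp]
  have := D.simple_tau hS
  have : Epi (D.tau.functor.map g) := inferInstance
  obtain ⟨m, hm, q, hq⟩ := D.sub_top h1 (D.simple_tau hS) (D.tau.functor.map g) hI (Abelian.image.ι f)
  have hS' : Simple (D.tau.functor.obj^[m + 1] S) := D.simple_iter hS (m + 1)
  change Abelian.image f ⟶ D.tau.functor.obj^[m + 1] S at q
  have hq' : Epi q := hq
  have : Epi (Abelian.factorThruImage f ≫ q) := epi_comp' inferInstance hq'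
  have h3 := D.free S hS (m + 1) (by omega)
    (top_unique (D.un _ hX) g (Abelian.factorThruImage f ≫ q))
  have h4 := len_pos hI (ch_mono (Abelian.image.ι f) (D.un _ h1)) (D.fl _)
  omega

lemma nonexc_of_full {X : A} (hX : Indecomposable X) (h : t ≤ len X) : ¬ Ext1IsZero X X := by
  rw [D.serre]
  push Not
  obtain ⟨S, g, hS, hg⟩ := exists_top D.fl hX.1
  obtain ⟨h1, h2⟩ := D.len_tau hX
  have hS' := D.simple_tau hS
  obtain ⟨i, hi, ⟨e⟩⟩ := D.orbit _ _ hS' hS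
  obtain ⟨Y, j, q, hj, hY, hl, hq⟩ := D.exists_sub h1 hS' (D.tau.functor.map g) i (by omega)
  have : Epi (q ≫ e.inv) := epi_comp' hq inferInstance
  have hj0 : j ≠ 0 := by
    rintro rfl
    exact hY.1 (IsZero.of_mono_zero Y (D.tau.functor.obj X))
  rcases same_top D.fl D.un hX hY g (q ≫ e.inv) with ⟨p, hp⟩ | ⟨p, hp⟩
  · refine ⟨p ≫ j, fun h0 => hj0 ?_⟩
    rw [← cancel_epi p, h0, comp_zero]
  · have := D.iso_of_epi p (D.un _ hY) (by omega)
    refine ⟨inv p ≫ j, fun h0 => hj0 ?_⟩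
    rw [← cancel_epi (inv p), h0, comp_zero]

/-- Nonzero maps between full indecomposables. -/
lemma exists_hom {X Y : A} (hX : Indecomposable X) (hY : Indecomposable Y) (hx : t ≤ len X)
    (hy : t ≤ len Y) : ∃ f : X ⟶ Y, f ≠ 0 := by
  have ht := D.ht
  obtain ⟨P, g, hP, hg⟩ := exists_top D.fl hX.1
  obtain ⟨S, s, hS, hs⟩ := exists_top D.fl hY.1
  obtain ⟨Y₀, i, q, hi, hY₀, hl, hq⟩ := D.exists_sub hY hS s (len Y - t) (by omega)
  have hS' := D.simple_iter hS (len Y - t)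
  obtain ⟨n, hn, ⟨e⟩⟩ := D.orbit _ _ hS' hP
  obtain ⟨Z, j, q', hj, hZ, hl', hq'⟩ := D.exists_sub hY₀ hS' q n (by omega)
  have : Epi (q' ≫ e.inv) := epi_comp' hq' inferInstance
  have hm : Mono (j ≫ i) := mono_comp _ _
  have hj0 : j ≫ i ≠ 0 := by
    intro h0
    rw [h0] at hm
    exact hZ.1 (IsZero.of_mono_zero Z Y)
  rcases same_top D.fl D.un hX hZ g (q' ≫ e.inv) with ⟨p, hp⟩ | ⟨p, hp⟩
  · refine ⟨p ≫ j ≫ i, fun h0 => hj0 ?_⟩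
    rw [← cancel_epi p, h0, comp_zero]
  · have := D.iso_of_epi p (D.un _ hZ) (by omega)
    refine ⟨inv p ≫ j ≫ i, fun h0 => hj0 ?_⟩
    rw [← cancel_epi (inv p), h0, comp_zero]

/-- Every indecomposable embeds properly into a longer one. -/
lemma extend_one {X : A} (hX : Indecomposable X) :
    ∃ (Q : A) (i : X ⟶ Q), Indecomposable Q ∧ Mono i ∧ len X < len Q := by
  obtain ⟨S, g, hS, hg⟩ := exists_top D.fl hX.1
  have hne : ¬ Ext1IsZero (D.tau.inverse.obj S) X := by
    rw [D.serre]
    intro h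
    have h1 := h (g ≫ (D.tau.counitIso.app S).inv)
    have : g = 0 := by
      rw [← cancel_mono (D.tau.counitIso.app S).inv, h1, zero_comp]
    rw [this] at hg
    exact Simple.not_isZero S (IsZero.of_epi_zero X S)
  unfold Ext1IsZero at hne
  push Not at hne
  obtain ⟨M, i, p, w, hi, hp, hex, hr⟩ := hne
  obtain ⟨Q, q, hQ, hq, hm⟩ := mono_detect D.fl hX.1 (D.un _ hX) M i hi
  refine ⟨Q, i ≫ q, hQ, hm, ?_⟩
  by_contra hlt
  have := D.iso_of_mono (i ≫ q) (D.un _ hQ) (by omega)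
  exact hr (q ≫ inv (i ≫ q)) (by rw [← Category.assoc, IsIso.hom_inv_id])

lemma extend {X : A} (hX : Indecomposable X) (n : ℕ) :
    ∃ (Q : A) (i : X ⟶ Q), Indecomposable Q ∧ Mono i ∧ len X + n ≤ len Q := by
  induction n with
  | zero => exact ⟨X, 𝟙 X, hX, inferInstance, by omega⟩
  | succ n ih =>
    obtain ⟨Q, i, hQ, hi, hl⟩ := ih
    obtain ⟨R, j, hR, hj, hl'⟩ := D.extend_one hQ
    exact ⟨R, i ≫ j, hR, mono_comp _ _, by omega⟩

end TD

/-- Torsion pairs. -/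
structure TP {A : Type u} [Category.{v} A] [Abelian A] (T F : A → Prop) : Prop where
  T_iso : ∀ X Y : A, (X ≅ Y) → T X → T Y
  F_iso : ∀ X Y : A, (X ≅ Y) → F X → F Y
  hom : ∀ X Y : A, T X → F Y → ∀ f : X ⟶ Y, f = 0
  fit : ∀ X : A, ∃ (Y Z : A) (i : Y ⟶ X) (p : X ⟶ Z) (w : i ≫ p = 0),
      T Y ∧ F Z ∧ Mono i ∧ Epi p ∧ (ShortComplex.mk i p w).Exact

namespace TP

variable {A : Type u} [Category.{v} A] [Abelian A] {T F : A → Prop} (h : TP T F)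

include h

lemma mem_T {X : A} (hX : ∀ (W : A) (f : X ⟶ W), Epi f → F W → IsZero W) : T X := by
  obtain ⟨Y, Z, i, p, w, hY, hZ, hi, hp, hex⟩ := h.fit X
  have h0 := hX Z p hp hZ
  have : Epi i := hex.epi_f (h0.eq_of_tgt _ _)
  have := isIso_of_mono_of_epi i
  exact h.T_iso _ _ (asIso i) hY

lemma T_quot {X Q : A} (hX : T X) (p : X ⟶ Q) [Epi p] : T Q := by
  refine h.mem_T fun W f hf hW => ?_
  have h1 := h.hom _ _ hX hW (p ≫ f)
  have : Epi (p ≫ f) := epi_comp' inferInstance hf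
  rw [h1] at this
  exact IsZero.of_epi_zero X W

lemma T_biprod {X Y : A} (hX : T X) (hY : T Y) : T (X ⊞ Y) := by
  refine h.mem_T fun W f hf hW => ?_
  have h1 := h.hom _ _ hX hW (biprod.inl ≫ f)
  have h2 := h.hom _ _ hY hW (biprod.inr ≫ f)
  have h3 : f = 0 := biprod.hom_ext' _ _ (by simpa using h1) (by simpa using h2)
  rw [h3] at hf
  exact IsZero.of_epi_zero (X ⊞ Y) W

lemma T_zero {X : A} (hX : IsZero X) : T X :=
  h.mem_T fun W f _ _ => IsZero.of_epi f hX

variable {t : ℕ} (D : TD t A)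
include D

lemma not_both {X Y : A} (hX : Indecomposable X) (hY : Indecomposable Y) (hx : t ≤ len X)
    (hy : t ≤ len Y) (hT : T X) (hF : F Y) : False := by
  obtain ⟨f, hf⟩ := D.exists_hom hX hY hx hy
  exact hf (h.hom _ _ hT hF f)

lemma tilting_of_full {X : A} (hX : Indecomposable X) (hx : t ≤ len X) (hT : T X) (Z : A) :
    ∃ (Y : A) (f : Z ⟶ Y), T Y ∧ Mono f := by
  refine decomp D.fl (fun Z => ∃ (Y : A) (f : Z ⟶ Y), T Y ∧ Mono f) ?_ ?_ ?_ ?_ Z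
  · rintro X Y e ⟨W, f, hW, hf⟩
    exact ⟨W, e.inv ≫ f, hW, mono_comp _ _⟩
  · intro X hX
    exact ⟨X, 𝟙 X, h.T_zero hX, inferInstance⟩
  · intro Z hZ
    obtain ⟨P, g, hP, hg⟩ := exists_top D.fl hX.1
    obtain ⟨Q, i, hQ, hi, hl⟩ := D.extend hZ t
    obtain ⟨S, s, hS, hs⟩ := exists_top D.fl hQ.1
    obtain ⟨n, hn, ⟨e⟩⟩ := D.orbit _ _ hS hP
    obtain ⟨Y, j, q, hj, hY, hl', hq⟩ := D.exists_sub hQ hS s n (by omega)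
    have hqe : Epi (q ≫ e.inv) := epi_comp' hq inferInstance
    obtain ⟨f, hf⟩ := D.factor (D.un _ hQ) i j (by omega)
    refine ⟨Y, f, ?_, mono_of_mono_fac hf⟩
    refine h.mem_T fun W p hp hW => ?_
    by_contra hW0
    obtain ⟨P', r, hP', hr⟩ := exists_top D.fl hW0
    have : Epi (p ≫ r) := epi_comp' hp hr
    obtain ⟨e'⟩ := top_unique (D.un _ hY) (p ≫ r) (q ≫ e.inv)
    have hWi := D.ind_epi p hW0 hY
    have : Epi (r ≫ e'.hom) := epi_comp' hr inferInstance
    rcases same_top D.fl D.un hX hWi g (r ≫ e'.hom) with ⟨c, hc⟩ | ⟨c, hc⟩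
    · have h0 := h.hom _ _ hT hW c
      rw [h0] at hc
      exact hW0 (IsZero.of_epi_zero X W)
    · have := D.len_kernel c (D.un _ hWi)
      exact h.not_both D hX hWi hx (by omega) hT hW
  · rintro X Y ⟨W, f, hW, hf⟩ ⟨W', f', hW', hf'⟩
    exact ⟨W ⊞ W', biprod.map f f', h.T_biprod hW hW', inferInstance⟩

lemma full_of_tilting (ht : ∀ Z : A, ∃ (Y : A) (f : Z ⟶ Y), T Y ∧ Mono f) :
    ∃ X, T X ∧ Indecomposable X ∧ t ≤ len X := by
  have := D.simple_S₀
  obtain ⟨Z, -, hZ, -, hl⟩ := D.extend (indecomposable_of_simple D.S₀) t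
  obtain ⟨Y, f, hY, hf⟩ := ht Z
  obtain ⟨Q, q, hQ, hq, hm⟩ := mono_detect D.fl hZ.1 (D.un _ hZ) Y f hf
  have := D.len_cokernel (f ≫ q) (D.un _ hQ)
  exact ⟨Q, h.T_quot hY q, hQ, by omega⟩

lemma exists_full : (∃ X, T X ∧ Indecomposable X ∧ t ≤ len X) ∨
    (∃ X, F X ∧ Indecomposable X ∧ t ≤ len X) := by
  have := D.simple_S₀
  have ht := D.ht
  obtain ⟨Z, -, hZ, -, hl⟩ := D.extend (indecomposable_of_simple D.S₀) (2 * t)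
  obtain ⟨Y, W, i, p, w, hY, hW, hi, hp, hex⟩ := h.fit Z
  have ha := len_add i p w hex (D.un _ hZ) (D.fl _)
  by_cases h1 : t ≤ len Y
  · left
    refine ⟨Y, hY, D.ind_mono i ?_ hZ, h1⟩
    intro h0
    rw [len_zero h0] at h1
    omega
  · right
    refine ⟨W, hW, D.ind_epi p ?_ hZ, by omega⟩
    intro h0
    rw [len_zero h0] at ha
    omega

lemma tilting_iff : (∀ Z : A, ∃ (Y : A) (f : Z ⟶ Y), T Y ∧ Mono f) ↔
    ∃ X : A, T X ∧ Indecomposable X ∧ ¬ Ext1IsZero X X := by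
  constructor
  · intro ht
    obtain ⟨X, h1, h2, h3⟩ := h.full_of_tilting D ht
    exact ⟨X, h1, h2, D.nonexc_of_full h2 h3⟩
  · rintro ⟨X, h1, h2, h3⟩
    exact h.tilting_of_full D h2 (D.full_of_nonexc h2 h3) h1

end TP
end TubeAux

namespace TubeAux

section Iter

variable {A : Type u} [Category.{v} A]

lemma iter_iso (G : A ⥤ A) {X Y : A} (h : Nonempty (X ≅ Y)) (n : ℕ) :
    Nonempty (G.obj^[n] X ≅ G.obj^[n] Y) := by
  induction n with
  | zero => exact h
  | succ n ih =>
    obtain ⟨e⟩ := ih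
    rw [Function.iterate_succ_apply', Function.iterate_succ_apply']
    exact ⟨G.mapIso e⟩

lemma iter_cancel (E : A ≌ A) {X Y : A} (n : ℕ)
    (h : Nonempty (E.functor.obj^[n] X ≅ E.functor.obj^[n] Y)) : Nonempty (X ≅ Y) := by
  induction n with
  | zero => exact h
  | succ n ih =>
    obtain ⟨e⟩ := h
    rw [Function.iterate_succ_apply', Function.iterate_succ_apply'] at e
    exact ih ⟨E.functor.preimageIso e⟩

lemma iter_inv (E : A ≌ A) (X : A) (n : ℕ) :
    Nonempty (E.functor.obj^[n] (E.inverse.obj^[n] X) ≅ X) := by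
  induction n with
  | zero => exact ⟨Iso.refl _⟩
  | succ n ih =>
    obtain ⟨e⟩ := ih
    rw [Function.iterate_succ_apply, Function.iterate_succ_apply']
    obtain ⟨e'⟩ := iter_iso E.functor ⟨E.counitIso.app (E.inverse.obj^[n] X)⟩ n
    exact ⟨e' ≪≫ e⟩

lemma fpow_obj (G : A ⥤ A) (n : ℕ) (X : A) : (fpow G n).obj X = G.obj^[n] X := by
  induction n with
  | zero => rfl
  | succ n ih =>
    rw [Function.iterate_succ_apply', ← ih]
    rfl

open Opposite in
lemma iter_op (G : A ⥤ A) (n : ℕ) (X : Aᵒᵖ) : G.op.obj^[n] X = op (G.obj^[n] (unop X)) := by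
  induction n with
  | zero => rfl
  | succ n ih =>
    rw [Function.iterate_succ_apply', Function.iterate_succ_apply', ih]
    rfl

end Iter

open Opposite

variable {A : Type u} [Category.{v} A] [Abelian A]

lemma ext_iff_section (X Y : A) : Ext1IsZero X Y ↔
    ∀ (M : A) (i : Y ⟶ M) (p : M ⟶ X) (w : i ≫ p = 0), Mono i → Epi p →
    (ShortComplex.mk i p w).Exact → ∃ s : X ⟶ M, s ≫ p = 𝟙 X := by
  constructor
  · intro h M i p w hi hp he
    obtain ⟨r, hr⟩ := h M i p w hi hp he
    let σ := ShortComplex.Splitting.ofExactOfRetraction (ShortComplex.mk i p w) he r hr hp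
    exact ⟨σ.s, σ.s_g⟩
  · intro h M i p w hi hp he
    obtain ⟨r, hr⟩ := h M i p w hi hp he
    let σ := ShortComplex.Splitting.ofExactOfSection (ShortComplex.mk i p w) he r hr hi
    exact ⟨σ.r, σ.f_r⟩

lemma ext_op (X Y : A) : Ext1IsZero (op Y) (op X) ↔ Ext1IsZero X Y := by
  constructor
  · intro h
    rw [ext_iff_section]
    intro M i p w hi hp he
    obtain ⟨r, hr⟩ := h (op M) p.op i.op (by rw [← op_comp, w, op_zero]) inferInstance
      inferInstance he.op
    exact ⟨r.unop, Quiver.Hom.op_inj hr⟩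
  · intro h
    rw [ext_iff_section] at h
    intro M i p w hi hp he
    obtain ⟨r, hr⟩ := h (unop M) p.unop i.unop (by rw [← unop_comp, w, unop_zero]) inferInstance
      inferInstance he.unop
    exact ⟨r.op, Quiver.Hom.unop_inj hr⟩

lemma isZero_op_iff (X : A) : IsZero (op X) ↔ IsZero X :=
  ⟨fun h => h.unop, fun h => h.op⟩

lemma indec_of_op {X : A} (h : Indecomposable (op X)) : Indecomposable X := by
  refine ⟨fun h0 => h.1 h0.op, fun Y Z e => ?_⟩
  have := h.2 (op Y) (op Z) (e.op.symm ≪≫ biprod.opIso Y Z)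
  simpa only [isZero_op_iff] using this

lemma simple_of_op {S : A} (h : Simple (op S)) : Simple S := by
  apply simple_of_cosimple
  intro Z f hf
  rw [← isIso_op_iff, Simple.mono_isIso_iff_nonzero]
  refine not_congr ⟨fun h => Quiver.Hom.op_inj (by rw [h, op_zero]), fun h => by rw [h, op_zero]⟩

lemma simple_op {S : A} (h : Simple S) : Simple (op S) := by
  apply simple_of_cosimple
  intro Z f hf
  rw [← isIso_unop_iff, Simple.mono_isIso_iff_nonzero]
  refine not_congr ⟨fun h => Quiver.Hom.unop_inj (by rw [h, unop_zero]),
    fun h => by rw [h, unop_zero]⟩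

lemma fl_op (fl : ∀ X : A, WellFoundedGT (Subobject X) ∧ WellFoundedLT (Subobject X))
    (X : Aᵒᵖ) : WellFoundedGT (Subobject X) ∧ WellFoundedLT (Subobject X) := by
  obtain ⟨h1, h2⟩ := fl (unop X)
  have e := (Abelian.subobjectIsoSubobjectOp (unop X))
  have h3 : WellFoundedGT (Subobject X)ᵒᵈ := e.symm.toOrderEmbedding.wellFoundedGT
  have h4 : WellFoundedLT (Subobject X)ᵒᵈ := e.symm.toOrderEmbedding.wellFoundedLT
  exact ⟨⟨h4.wf⟩, ⟨h3.wf⟩⟩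

/-- The dual tube data. -/
noncomputable def TD.dual {t : ℕ} (D : TD t A) : TD t Aᵒᵖ where
  ht := D.ht
  fl := fl_op D.fl
  un X hX := ch_op (D.un _ (indec_of_op (X := unop X) hX))
  tau := D.tau.symm.op
  serre X Y := by
    refine (ext_op (unop Y) (unop X)).trans ((D.serre _ _).trans ?_)
    constructor
    · intro h f
      change Y ⟶ op (D.tau.inverse.obj (unop X)) at f
      apply Quiver.Hom.unop_inj
      apply (D.tau.symm.toAdjunction.homEquiv _ _).injective
      exact (h _).trans (h _).symm
    · intro h f
      apply (D.tau.symm.toAdjunction.homEquiv _ _).symm.injective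
      apply Quiver.Hom.op_inj
      exact (h _).trans (h _).symm
  S₀ := op D.S₀
  simple_S₀ := simple_op D.simple_S₀
  orbit S S' hS hS' := by
    obtain ⟨i, hi, ⟨e⟩⟩ := D.orbit (unop S') (unop S) (simple_of_op hS') (simple_of_op hS)
    refine ⟨i, hi, ?_⟩
    obtain ⟨e'⟩ := iter_inv D.tau (unop S) i
    obtain ⟨e''⟩ := iter_cancel D.tau i ⟨e' ≪≫ e⟩
    change Nonempty (S' ≅ D.tau.inverse.op.obj^[i] S)
    rw [iter_op]
    exact ⟨e''.op⟩
  free S hS m hm h := by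
    change Nonempty (S ≅ D.tau.inverse.op.obj^[m] S) at h
    rw [iter_op] at h
    obtain ⟨e⟩ := h
    obtain ⟨e1⟩ := iter_iso D.tau.functor ⟨e.unop⟩ m
    obtain ⟨e'⟩ := iter_inv D.tau (unop S) m
    exact D.free (unop S) (simple_of_op hS) m hm ⟨e'.symm ≪≫ e1⟩

lemma TP.dual {T F : A → Prop} (h : TP T F) :
    TP (fun X : Aᵒᵖ => F (unop X)) (fun X : Aᵒᵖ => T (unop X)) where
  T_iso X Y e hX := h.F_iso _ _ e.unop.symm hX
  F_iso X Y e hX := h.T_iso _ _ e.unop.symm hX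
  hom X Y hX hY f := Quiver.Hom.unop_inj (h.hom _ _ hY hX f.unop)
  fit X := by
    obtain ⟨Y, Z, i, p, w, hY, hZ, hi, hp, hex⟩ := h.fit (unop X)
    exact ⟨op Z, op Y, p.op, i.op, by rw [← op_comp, w, op_zero], hZ, hY, inferInstance,
      inferInstance, hex.op⟩

lemma TP.cotilting_iff {T F : A → Prop} (h : TP T F) {t : ℕ} (D : TD t A) :
    (∀ X : A, ∃ (Y : A) (f : Y ⟶ X), F Y ∧ Epi f) ↔
        ∃ X : A, F X ∧ Indecomposable X ∧ ¬ Ext1IsZero X X := by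
  have key := h.dual.tilting_iff D.dual
  constructor
  · intro hc
    obtain ⟨X, h1, h2, h3⟩ := key.1 (fun Z => by
      obtain ⟨Y, f, hY, hf⟩ := hc (unop Z)
      exact ⟨op Y, f.op, hY, inferInstance⟩)
    exact ⟨unop X, h1, indec_of_op h2, fun h4 => h3 ((ext_op _ _).2 h4)⟩
  · rintro ⟨X, h1, h2, h3⟩ Z
    have h2' : Indecomposable (op X) :=
      indec_of_ch (fun h0 => h2.1 h0.unop) (ch_op (D.un _ h2))
    obtain ⟨Y, f, hY, hf⟩ := key.2 ⟨op X, h1, h2', fun h4 => h3 ((ext_op _ _).1 h4)⟩ (op Z)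
    exact ⟨unop Y, f.unop, hY, inferInstance⟩

/-- Extract the clean data from the given data. -/
noncomputable def toTD {k : Type*} [Field k] [Linear k A] {t : ℕ} (ht : 0 < t)
    (N : NilpTubeData k t A) : TD t A where
  ht := ht
  fl := N.finiteLength
  un := N.uniserial
  tau := N.tau
  serre := N.serre
  S₀ := N.S₀
  simple_S₀ := N.simple_S₀
  orbit S S' hS hS' := by
    obtain ⟨i, ⟨e⟩⟩ := N.simples_orbit S hS
    obtain ⟨j, ⟨e'⟩⟩ := N.simples_orbit S' hS'
    rw [fpow_obj] at e e'
    have hi := i.2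
    have hj := j.2
    obtain ⟨p⟩ := N.tau_period
    have p' := p.app N.S₀
    rw [fpow_obj] at p'
    by_cases hij : (i : ℕ) ≤ j
    · refine ⟨j - i, by omega, ?_⟩
      obtain ⟨e1⟩ := iter_iso N.tau.functor ⟨e⟩ (j - i)
      rw [← Function.iterate_add_apply, Nat.sub_add_cancel hij] at e1
      exact ⟨e' ≪≫ e1.symm⟩
    · refine ⟨j + t - i, by omega, ?_⟩
      obtain ⟨e1⟩ := iter_iso N.tau.functor ⟨e⟩ (j + t - i)
      rw [← Function.iterate_add_apply, Nat.sub_add_cancel (by omega),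
        Function.iterate_add_apply] at e1
      obtain ⟨e2⟩ := iter_iso N.tau.functor ⟨p'⟩ j
      exact ⟨e' ≪≫ e2.symm ≪≫ e1.symm⟩
  free S hS m hm h := by
    by_contra hlt
    obtain ⟨i, ⟨e⟩⟩ := N.simples_orbit S hS
    rw [fpow_obj] at e
    obtain ⟨e1⟩ := h
    obtain ⟨e2⟩ := iter_iso N.tau.functor ⟨e⟩ m
    rw [← Function.iterate_add_apply, Nat.add_comm, Function.iterate_add_apply] at e2
    obtain ⟨e3⟩ := iter_cancel N.tau i ⟨e.symm ≪≫ e1 ≪≫ e2⟩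
    have := N.orbit_distinct ⟨0, ht⟩ ⟨m, by omega⟩ (by
      rw [fpow_obj, fpow_obj]
      exact ⟨e3⟩)
    simp at this
    omega

end TubeAux

end AuxPart

variable {A : Type u} [Category.{v} A] [Abelian A] [Linear k A]

/-- Let `(T, F)` be a torsion pair in `A_t`.  Then `T` is a tilting torsion class iff `T`
contains a non-exceptional indecomposable object, `F` is a cotilting torsion-free class iff
`F` contains a non-exceptional indecomposable object, and exactly one of these two
alternatives holds. -/
theorem torsionPair_tilting_or_cotilting
    (t : ℕ) (ht : 0 < t) (ND : NilpTubeData k t A)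
    (T F : A → Prop)
    (hT_iso : ∀ X Y : A, (X ≅ Y) → T X → T Y)
    (hF_iso : ∀ X Y : A, (X ≅ Y) → F X → F Y)
    (hHom : ∀ X Y : A, T X → F Y → ∀ f : X ⟶ Y, f = 0)
    (hFit : ∀ X : A, ∃ (Y Z : A) (i : Y ⟶ X) (p : X ⟶ Z) (w : i ≫ p = 0),
      T Y ∧ F Z ∧ Mono i ∧ Epi p ∧ (ShortComplex.mk i p w).Exact) :
    ((∀ X : A, ∃ (Y : A) (f : X ⟶ Y), T Y ∧ Mono f) ↔
        ∃ X : A, T X ∧ Indecomposable X ∧ ¬ Ext1IsZero (A := A) X X) ∧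
    ((∀ X : A, ∃ (Y : A) (f : Y ⟶ X), F Y ∧ Epi f) ↔
        ∃ X : A, F X ∧ Indecomposable X ∧ ¬ Ext1IsZero (A := A) X X) ∧
    Xor' (∀ X : A, ∃ (Y : A) (f : X ⟶ Y), T Y ∧ Mono f)
      (∀ X : A, ∃ (Y : A) (f : Y ⟶ X), F Y ∧ Epi f) := by
  have D := TubeAux.toTD ht ND
  have h : TubeAux.TP T F := ⟨hT_iso, hF_iso, hHom, hFit⟩
  have h1 := h.tilting_iff D
  have h2 := h.cotilting_iff D
  refine ⟨h1, h2, ?_⟩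
  have hnot : ¬ ((∃ X : A, T X ∧ Indecomposable X ∧ ¬ Ext1IsZero (A := A) X X) ∧
      ∃ X : A, F X ∧ Indecomposable X ∧ ¬ Ext1IsZero (A := A) X X) := by
    rintro ⟨⟨X, hX, iX, eX⟩, ⟨Y, hY, iY, eY⟩⟩
    exact h.not_both D iX iY (D.full_of_nonexc iX eX) (D.full_of_nonexc iY eY) hX hY
  rw [h1, h2]
  rcases h.exists_full D with ⟨X, hX, iX, lX⟩ | ⟨X, hX, iX, lX⟩
  · have hT : ∃ X : A, T X ∧ Indecomposable X ∧ ¬ Ext1IsZero (A := A) X X :=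
      ⟨X, hX, iX, D.nonexc_of_full iX lX⟩
    exact Or.inl ⟨hT, fun hF => hnot ⟨hT, hF⟩⟩
  · have hF : ∃ X : A, F X ∧ Indecomposable X ∧ ¬ Ext1IsZero (A := A) X X :=
      ⟨X, hX, iX, D.nonexc_of_full iX lX⟩
    exact Or.inr ⟨hF, fun hT => hnot ⟨hT, hF⟩⟩
end
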